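/- Global dimension-free Hessian estimate (finite parameters). Let n ≥ 1 be an integer and let d, D be reals with n ≤ d ≤ D < ∞. Let V, W : ℝⁿ → ℝ be C² potentials with V > −d and W > −D pointwise, with Z_{V,d} and Z_{W,D} finite, and with D²V ≤ C_V⁽²⁾·Id and D²W ≥ c_W⁽²⁾·Id for some 0 < c_W⁽²⁾, C_V⁽²⁾ < ∞. Let φ : ℝⁿ → ℝ be convex and C² with (∇φ)_# μ_{V,d} = μ_{W,D}. Assume c⁽⁰⁾_{V,n} > 0, c⁽⁰⁾_{W,n} > 0 and that C⁽⁰⁾_{V,n}, C⁽⁰⁾_{W,n}, C⁽¹⁾_{V,n}, C⁽¹⁾_{W,n} are finite. Set q_V = max{1, C⁽⁰⁾_{V,n}}/min{1, c⁽⁰⁾_{V,n}}, q_W = max{1, C⁽⁰⁾_{W,n}}/min{1, c⁽⁰⁾_{W,n}}, 𝔠_V = min{1, c⁽⁰⁾_{V,n}}, 𝔔_W = max{1, C⁽⁰⁾_{W,n}}, L_V = C⁽¹⁾_{V,n}, L_W = C⁽¹⁾_{W,n}, M = 10⁶·q_V²·q_W², A = C_V⁽²⁾·𝔔_W·M/(c_W⁽²⁾·𝔠_V),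 B = 8·L_V·L_W·M/((c_W⁽²⁾)²·𝔠_V²), and C_glob = √(A + B) + √B. Then for every x ∈ ℝⁿ and every unit vector e, ⟨D²φ(x)e, e⟩ ≤ C_glob; equivalently, ∇φ is Lipschitz with constant C_glob. -/

import Mathlib

open MeasureTheory Metric Set
open scoped ENNReal RealInnerProductSpace

noncomputable section

/-- Euclidean space `ℝⁿ`. -/
abbrev Euc (n : ℕ) := EuclideanSpace ℝ (Fin n)

/-- The second directional derivative `⟨D²f(x)v, v⟩`. -/
def hess {n : ℕ} (f : Euc n → ℝ) (x v : Euc n) : ℝ :=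
  iteratedFDeriv ℝ 2 f x ![v, v]

/-- The normalization constant `Z_{U,p} = ∫ (1 + U(x)/p)^(−p) dx`. -/
def Znorm {n : ℕ} (U : Euc n → ℝ) (p : ℝ) : ℝ :=
  ∫ x, (1 + U x / p) ^ (-p)

/-- The measure `μ_{U,p}` with density `Z_{U,p}⁻¹ (1 + U(x)/p)^(−p)` w.r.t. Lebesgue. -/
def muUP {n : ℕ} (U : Euc n → ℝ) (p : ℝ) : Measure (Euc n) :=
  volume.withDensity fun x => ENNReal.ofReal ((Znorm U p)⁻¹ * (1 + U x / p) ^ (-p))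

/-- The ratio `(p + U(x))/(p + |x|²)`. -/
def ratio0 {n : ℕ} (U : Euc n → ℝ) (p : ℝ) (x : Euc n) : ℝ :=
  (p + U x) / (p + ‖x‖ ^ 2)

/-- The ratio `|∇U(x)|²/(√p + |x|)²`. -/
def ratio1 {n : ℕ} (U : Euc n → ℝ) (p : ℝ) (x : Euc n) : ℝ :=
  ‖gradient U x‖ ^ 2 / (Real.sqrt p + ‖x‖) ^ 2

/-- `c⁽⁰⁾_{U,p}(S) = inf_{x ∈ S} (p + U(x))/(p + |x|²)`. -/
def cLow {n : ℕ} (U : Euc n → ℝ) (p : ℝ) (S : Set (Euc n)) : ℝ := sInf (ratio0 U p '' S)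

/-- `C⁽⁰⁾_{U,p}(S) = sup_{x ∈ S} (p + U(x))/(p + |x|²)`. -/
def cUp {n : ℕ} (U : Euc n → ℝ) (p : ℝ) (S : Set (Euc n)) : ℝ := sSup (ratio0 U p '' S)

/-- `C⁽¹⁾_{U,p}(S) = sup_{x ∈ S} |∇U(x)|²/(√p + |x|)²`. -/
def cGrad {n : ℕ} (U : Euc n → ℝ) (p : ℝ) (S : Set (Euc n)) : ℝ := sSup (ratio1 U p '' S)

/-- The Lebesgue volume of the unit ball in `ℝⁿ`. -/
def unitBallVol (n : ℕ) : ℝ := (volume (ball (0 : Euc n) 1)).toReal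

lemma grad_contDiff {n : ℕ} {f : Euc n → ℝ} (hf : ContDiff ℝ 2 f) :
    ContDiff ℝ 1 (gradient f) := by
  have h1 : ContDiff ℝ 1 (fderiv ℝ f) := hf.fderiv_right (by norm_num)
  exact (InnerProductSpace.toDual ℝ (Euc n)).symm.contDiff.comp h1

lemma hess_eq {n : ℕ} {f : Euc n → ℝ} (hf : ContDiff ℝ 2 f) (x v : Euc n) :
    hess f x v = ⟪fderiv ℝ (gradient f) x v, v⟫ := by
  have h1 : ContDiff ℝ 1 (fderiv ℝ f) := hf.fderiv_right (by norm_num)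
  have h2 : HasFDerivAt (fderiv ℝ f) (fderiv ℝ (fderiv ℝ f) x) x :=
    (h1.differentiable (by norm_num) x).hasFDerivAt
  have h3 : fderiv ℝ (gradient f) x =
      ((InnerProductSpace.toDual ℝ (Euc n)).symm.toContinuousLinearEquiv.toContinuousLinearMap).comp
        (fderiv ℝ (fderiv ℝ f) x) := by
    apply HasFDerivAt.fderiv
    exact ((InnerProductSpace.toDual ℝ (Euc n)).symm.toContinuousLinearEquiv.toContinuousLinearMap.hasFDerivAt).comp x h2
  rw [hess, iteratedFDeriv_two_apply, h3]
  simp [InnerProductSpace.toDual_symm_apply]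

lemma hess_symm {n : ℕ} {f : Euc n → ℝ} (hf : ContDiff ℝ 2 f) (x v w : Euc n) :
    ⟪fderiv ℝ (gradient f) x v, w⟫ = ⟪v, fderiv ℝ (gradient f) x w⟫ := by
  have h1 : ContDiff ℝ 1 (fderiv ℝ f) := hf.fderiv_right (by norm_num)
  have h2 : HasFDerivAt (fderiv ℝ f) (fderiv ℝ (fderiv ℝ f) x) x :=
    (h1.differentiable (by norm_num) x).hasFDerivAt
  have h3 : fderiv ℝ (gradient f) x =
      ((InnerProductSpace.toDual ℝ (Euc n)).symm.toContinuousLinearEquiv.toContinuousLinearMap).comp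
        (fderiv ℝ (fderiv ℝ f) x) := by
    apply HasFDerivAt.fderiv
    exact ((InnerProductSpace.toDual ℝ (Euc n)).symm.toContinuousLinearEquiv.toContinuousLinearMap.hasFDerivAt).comp x h2
  have h4 : IsSymmSndFDerivAt ℝ f x := hf.contDiffAt.isSymmSndFDerivAt (by simp)
  rw [h3, real_inner_comm _ v]
  simp only [ContinuousLinearMap.comp_apply]
  have e1 : ∀ a b : Euc n, ⟪((InnerProductSpace.toDual ℝ (Euc n)).symm.toContinuousLinearEquiv.toContinuousLinearMap)
    (fderiv ℝ (fderiv ℝ f) x a), b⟫ = fderiv ℝ (fderiv ℝ f) x a b := by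
    intro a b; simp [InnerProductSpace.toDual_symm_apply]
  rw [e1, e1]
  exact h4 v w

lemma line_deriv {n : ℕ} {f : Euc n → ℝ} (hf : ContDiff ℝ 2 f) (x v : Euc n) (t : ℝ) :
    HasDerivAt (fun t : ℝ => f (x + t • v)) ⟪gradient f (x + t • v), v⟫ t := by
  have h1 : HasFDerivAt f (fderiv ℝ f (x + t • v)) (x + t • v) :=
    (hf.differentiable (by norm_num) _).hasFDerivAt
  have h2 : HasDerivAt (fun t : ℝ => x + t • v) v t := by
    simpa using ((hasDerivAt_id t).smul_const v).const_add x
  have := h1.comp_hasDerivAt t h2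
  rw [inner_gradient_left]
  exact this

lemma line_deriv2 {n : ℕ} {f : Euc n → ℝ} (hf : ContDiff ℝ 2 f) (x v : Euc n) (t : ℝ) :
    HasDerivAt (fun t : ℝ => ⟪gradient f (x + t • v), v⟫) (hess f (x + t • v) v) t := by
  have h1 : HasFDerivAt (gradient f) (fderiv ℝ (gradient f) (x + t • v)) (x + t • v) :=
    ((grad_contDiff hf).differentiable (by norm_num) _).hasFDerivAt
  have h2 : HasDerivAt (fun t : ℝ => x + t • v) v t := by
    simpa using ((hasDerivAt_id t).smul_const v).const_add x
  have := (h1.comp_hasDerivAt t h2).inner ℝ (hasDerivAt_const t v)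
  rw [hess_eq hf]
  simpa using this

lemma quad_upper_1d (g g' g'' : ℝ → ℝ) (K : ℝ) (h1 : ∀ t, HasDerivAt g (g' t) t)
    (h2 : ∀ t, HasDerivAt g' (g'' t) t) (h3 : ∀ t, g'' t ≤ K) :
    g 1 ≤ g 0 + g' 0 + K / 2 := by
  have a1 : Antitone (fun t => g' t - K * t) := by
    apply antitone_of_hasDerivAt_nonpos (f' := fun t => g'' t - K)
    · intro t
      have := (h2 t).sub ((hasDerivAt_id t).const_mul K)
      rw [mul_one] at this
      exact this
    · intro t; simpa using h3 t
  have hd : ∀ t, HasDerivAt (fun t => g t - g' 0 * t - K * t ^ 2 / 2) (g' t - g' 0 - K * t) t := by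
    intro t
    have e2 : HasDerivAt (fun t : ℝ => K * t ^ 2 / 2) (K * t) t := by
      have := (((hasDerivAt_id t).pow 2).const_mul K).div_const 2
      refine this.congr_deriv ?_
      simp; ring
    exact (((h1 t).sub (by simpa using (hasDerivAt_id t).const_mul (g' 0)))).sub e2
  have a2 : AntitoneOn (fun t => g t - g' 0 * t - K * t ^ 2 / 2) (Icc 0 1) := by
    apply antitoneOn_of_deriv_nonpos (convex_Icc 0 1)
    · exact fun t _ => (hd t).continuousAt.continuousWithinAt
    · exact fun t _ => (hd t).differentiableAt.differentiableWithinAt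
    · intro t ht
      rw [interior_Icc] at ht
      rw [(hd t).deriv]
      have := a1 ht.1.le
      simp at this
      linarith
  have := a2 (left_mem_Icc.2 zero_le_one) (right_mem_Icc.2 zero_le_one) zero_le_one
  simp at this
  linarith

lemma quad_upper {n : ℕ} {f : Euc n → ℝ} (hf : ContDiff ℝ 2 f) {C : ℝ}
    (h : ∀ x v : Euc n, hess f x v ≤ C * ‖v‖ ^ 2) (x v : Euc n) :
    f (x + v) ≤ f x + ⟪gradient f x, v⟫ + C * ‖v‖ ^ 2 / 2 := by
  have := quad_upper_1d _ _ _ (C * ‖v‖ ^ 2) (line_deriv hf x v) (line_deriv2 hf x v)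
    (fun t => h _ _)
  simpa using this

lemma quad_lower {n : ℕ} {f : Euc n → ℝ} (hf : ContDiff ℝ 2 f) {c : ℝ}
    (h : ∀ x v : Euc n, c * ‖v‖ ^ 2 ≤ hess f x v) (x v : Euc n) :
    f x + ⟪gradient f x, v⟫ + c * ‖v‖ ^ 2 / 2 ≤ f (x + v) := by
  have := quad_upper_1d (fun t => - f (x + t • v)) (fun t => -⟪gradient f (x + t • v), v⟫)
    (fun t => - hess f (x + t • v) v) (-(c * ‖v‖ ^ 2)) (fun t => (line_deriv hf x v t).neg)
    (fun t => (line_deriv2 hf x v t).neg)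
    (fun t => neg_le_neg (h _ _))
  simp [-inner_gradient_left] at this
  linarith

lemma conv_grad {n : ℕ} {f : Euc n → ℝ} (hf : ContDiff ℝ 2 f) (hc : ConvexOn ℝ univ f)
    (x y : Euc n) : f x + ⟪gradient f x, y - x⟫ ≤ f y := by
  have hg : ConvexOn ℝ univ (fun t : ℝ => f (x + t • (y - x))) := by
    have := hc.comp_affineMap (AffineMap.lineMap x y : ℝ →ᵃ[ℝ] Euc n)
    rw [preimage_univ] at this
    have e : (fun t : ℝ => f (x + t • (y - x))) = f ∘ (AffineMap.lineMap x y : ℝ →ᵃ[ℝ] Euc n) := by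
      ext t
      simp [AffineMap.lineMap_apply, add_comm]
    rw [e]
    exact this
  have h0 := line_deriv hf x (y - x) 0
  have := hg.le_slope_of_hasDerivAt (mem_univ 0) (mem_univ 1) zero_lt_one h0
  simp [slope, -inner_gradient_left] at this
  linarith

lemma conv_mono {n : ℕ} {f : Euc n → ℝ} (hf : ContDiff ℝ 2 f) (hc : ConvexOn ℝ univ f)
    (x y : Euc n) : 0 ≤ ⟪gradient f y - gradient f x, y - x⟫ := by
  have h1 := conv_grad hf hc x y
  have h2 := conv_grad hf hc y x
  have : ⟪gradient f y, x - y⟫ = - ⟪gradient f y, y - x⟫ := by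
    rw [← inner_neg_right]; simp
  rw [inner_sub_left]
  linarith

lemma conv_hess {n : ℕ} {f : Euc n → ℝ} (hf : ContDiff ℝ 2 f) (hc : ConvexOn ℝ univ f)
    (x v : Euc n) : 0 ≤ hess f x v := by
  have h := line_deriv2 hf x v 0
  simp only [zero_smul, add_zero] at h
  have hm : Monotone (fun t : ℝ => ⟪gradient f (x + t • v), v⟫) := by
    intro s t hst
    rcases hst.eq_or_lt with rfl | hlt
    · exact le_rfl
    have := conv_mono hf hc (x + s • v) (x + t • v)
    have e : (x + t • v) - (x + s • v) = (t - s) • v := by rw [sub_smul]; abel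
    rw [e, inner_smul_right, inner_sub_left] at this
    have h3 := nonneg_of_mul_nonneg_right this (sub_pos.2 hlt)
    simp only; linarith
  rw [← h.deriv]
  exact hm.deriv_nonneg

lemma psd_det_rpow {n : ℕ} (P : Matrix (Fin n) (Fin n) ℝ) (hP : P.PosSemidef) (D : ℝ)
    (hD : 0 < D) (hn : (n : ℝ) ≤ D) :
    P.det ^ (1 / D) ≤ 1 + (P.trace - n) / D := by
  have hH := hP.isHermitian
  have hnn := hP.eigenvalues_nonneg
  have hdet := hH.det_eq_prod_eigenvalues
  have htr := hH.trace_eq_sum_eigenvalues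
  simp only [RCLike.ofReal_real_eq_id, id] at hdet htr
  have := Real.geom_mean_le_arith_mean_weighted (Finset.univ : Finset (Option (Fin n)))
    (fun o => o.elim (1 - n / D) (fun _ => 1 / D)) (fun o => o.elim 1 (fun i => hH.eigenvalues i))
    (by
      intro i _
      cases i with
      | none => simp; exact (div_le_one hD).2 hn
      | some i => simp; positivity)
    (by simp [Fintype.sum_option]; field_simp; ring)
    (by
      intro i _
      cases i with
      | none => simp
      | some i => simpa using hnn i)
  simp only [Fintype.prod_option, Fintype.sum_option, Option.elim, Real.one_rpow, one_mul] at this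
  rw [Real.finsetProd_rpow _ _ (fun i _ => hnn i), ← Finset.mul_sum, ← hdet, ← htr] at this
  refine this.trans (le_of_eq ?_)
  field_simp
  ring

open scoped MatrixOrder ComplexOrder in
lemma psd_factor {n : ℕ} (A : Matrix (Fin n) (Fin n) ℝ) (hA : A.PosSemidef) :
    ∃ B : Matrix (Fin n) (Fin n) ℝ, A = B.conjTranspose * B := by
  have h := CStarAlgebra.nonneg_iff_eq_star_mul_self.1 (Matrix.nonneg_iff_posSemidef.2 hA)
  exact h

lemma det_concave_matrix {n : ℕ} (A P Q : Matrix (Fin n) (Fin n) ℝ) (hA : A.PosSemidef)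
    (hdA : A.det ≠ 0) (hP : P.PosSemidef) (hQ : Q.PosSemidef) (τ D : ℝ) (hτ : 1 ≤ τ)
    (hD : 0 < D) (hn : (n : ℝ) ≤ D) (h : ((2 * τ) • A - P - Q).PosSemidef) :
    P.det ^ (1 / D) + Q.det ^ (1 / D) ≤ 2 * τ * A.det ^ (1 / D) := by
  obtain ⟨B, hB⟩ := psd_factor A hA
  have hdB : A.det = B.det ^ 2 := by rw [hB]; simp [sq]
  have hB0 : B.det ≠ 0 := by intro h0; rw [h0] at hdB; simp at hdB; exact hdA hdB
  have hBu : IsUnit B.det := isUnit_iff_ne_zero.2 hB0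
  set E := B⁻¹ with hE
  have hBE : B * E = 1 := Matrix.mul_nonsing_inv B hBu
  have hEA : E.conjTranspose * A * E = 1 := by
    rw [hB]
    calc E.conjTranspose * (B.conjTranspose * B) * E
        = (B * E).conjTranspose * (B * E) := by
          rw [Matrix.conjTranspose_mul]; simp only [Matrix.mul_assoc]
      _ = 1 := by rw [hBE]; simp
  have hdE : E.det ^ 2 * A.det = 1 := by
    have := congrArg Matrix.det hEA
    simp at this
    linarith
  have hP' := hP.conjTranspose_mul_mul_same E
  have hQ' := hQ.conjTranspose_mul_mul_same E
  have h' := (h.conjTranspose_mul_mul_same E).trace_nonneg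
  have hApos : 0 < A.det := lt_of_le_of_ne hA.det_nonneg (Ne.symm hdA)
  have htr : (E.conjTranspose * P * E).trace + (E.conjTranspose * Q * E).trace ≤ 2 * τ * n := by
    have e : E.conjTranspose * ((2 * τ) • A - P - Q) * E
        = (2 * τ) • (1 : Matrix (Fin n) (Fin n) ℝ) - E.conjTranspose * P * E
          - E.conjTranspose * Q * E := by
      rw [← hEA]
      simp only [Matrix.mul_sub, Matrix.sub_mul, Matrix.mul_smul, Matrix.smul_mul]
    rw [e] at h'
    simp only [Matrix.trace_sub, Matrix.trace_smul, Matrix.trace_one, Fintype.card_fin, smul_eq_mul] at h'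
    linarith
  have key : ∀ P : Matrix (Fin n) (Fin n) ℝ, P.PosSemidef →
      (E.conjTranspose * P * E).det ^ (1 / D) * A.det ^ (1 / D) = P.det ^ (1 / D) := by
    intro P hP
    rw [← Real.mul_rpow (hP.conjTranspose_mul_mul_same E).det_nonneg hApos.le]
    congr 1
    simp
    calc E.det * P.det * E.det * A.det = P.det * (E.det ^ 2 * A.det) := by ring
      _ = P.det := by rw [hdE]; ring
  rw [← key P hP, ← key Q hQ, ← add_mul]
  apply mul_le_mul_of_nonneg_right _ (Real.rpow_nonneg hApos.le _)
  have h1 := psd_det_rpow _ hP' D hD hn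
  have h2 := psd_det_rpow _ hQ' D hD hn
  have h3 : ((E.conjTranspose * P * E).trace - n) / D + ((E.conjTranspose * Q * E).trace - n) / D
      ≤ 2 * (τ - 1) := by
    rw [← add_div, div_le_iff₀ hD]
    have : (n : ℝ) * (τ - 1) ≤ D * (τ - 1) := mul_le_mul_of_nonneg_right hn (by linarith)
    linarith
  linarith

lemma clm_psd {n : ℕ} (S : Euc n →L[ℝ] Euc n) (hs : ∀ v w, ⟪S v, w⟫ = ⟪v, S w⟫)
    (hp : ∀ v, 0 ≤ ⟪S v, v⟫) :
    (Matrix.toEuclideanLin.symm (S : Euc n →ₗ[ℝ] Euc n)).PosSemidef := by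
  rw [← Matrix.isPositive_toEuclideanLin_iff, LinearEquiv.apply_symm_apply]
  exact ⟨hs, hp⟩

lemma clm_det {n : ℕ} (S : Euc n →L[ℝ] Euc n) :
    (Matrix.toEuclideanLin.symm (S : Euc n →ₗ[ℝ] Euc n)).det = S.det := by
  rw [ContinuousLinearMap.det]
  conv_rhs => rw [← LinearEquiv.apply_symm_apply Matrix.toEuclideanLin (S : Euc n →ₗ[ℝ] Euc n)]
  exact (LinearMap.det_toLin (PiLp.basisFun 2 ℝ (Fin n)) _).symm

lemma det_concave {n : ℕ} (A P Q : Euc n →L[ℝ] Euc n)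
    (hA : ∀ v w, ⟪A v, w⟫ = ⟪v, A w⟫) (hP : ∀ v w, ⟪P v, w⟫ = ⟪v, P w⟫)
    (hQ : ∀ v w, ⟪Q v, w⟫ = ⟪v, Q w⟫)
    (hA0 : ∀ v, 0 ≤ ⟪A v, v⟫) (hP0 : ∀ v, 0 ≤ ⟪P v, v⟫) (hQ0 : ∀ v, 0 ≤ ⟪Q v, v⟫)
    (hdA : A.det ≠ 0) (τ D : ℝ) (hτ : 1 ≤ τ)
    (hD : 0 < D) (hn : (n : ℝ) ≤ D)
    (h : ∀ v, ⟪P v, v⟫ + ⟪Q v, v⟫ ≤ 2 * τ * ⟪A v, v⟫) :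
    P.det ^ (1 / D) + Q.det ^ (1 / D) ≤ 2 * τ * A.det ^ (1 / D) := by
  rw [← clm_det A, ← clm_det P, ← clm_det Q]
  apply det_concave_matrix _ _ _ (clm_psd A hA hA0) (by rwa [clm_det]) (clm_psd P hP hP0)
    (clm_psd Q hQ hQ0) τ D hτ hD hn
  have := clm_psd ((2 * τ) • A - P - Q)
    (by intro v w; simp [inner_sub_left, inner_sub_right, inner_smul_left, inner_smul_right, hA v w, hP v w, hQ v w])
    (by
      intro v
      have := h v
      simp [inner_sub_left, inner_smul_left]
      linarith)
  convert this using 1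
  simp

lemma det_nonneg_of_psd {n : ℕ} (S : Euc n →L[ℝ] Euc n) (hs : ∀ v w, ⟪S v, w⟫ = ⟪v, S w⟫)
    (hp : ∀ v, 0 ≤ ⟪S v, v⟫) : 0 ≤ S.det := by
  rw [← clm_det]
  exact (clm_psd S hs hp).det_nonneg

lemma psd_zero {n : ℕ} (S : Euc n →L[ℝ] Euc n) (hs : ∀ v w, ⟪S v, w⟫ = ⟪v, S w⟫)
    (hp : ∀ v, 0 ≤ ⟪S v, v⟫) (hd : S.det ≠ 0) (v : Euc n) (hv : ⟪S v, v⟫ = 0) : v = 0 := by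
  have hz : S v = 0 := by
    have h1 : ∀ t : ℝ, 0 ≤ 2 * t * ⟪S v, S v⟫ + t ^ 2 * ⟪S (S v), S v⟫ := by
      intro t
      have := hp (v + t • S v)
      simp only [map_add, map_smul, inner_add_left, inner_add_right, inner_smul_left,
        inner_smul_right, hv] at this
      rw [hs (S v) v] at this
      simp at this
      rw [real_inner_self_eq_norm_sq]
      nlinarith
    by_contra hne
    have ha : 0 < ⟪S v, S v⟫ := real_inner_self_pos.2 hne
    have hb := hp (S v)
    set a := ⟪S v, S v⟫
    set b := ⟪S (S v), S v⟫
    have := h1 (-(a / (b + 1)))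
    have hb1 : 0 < b + 1 := by linarith
    have e : 2 * -(a / (b + 1)) * a + (-(a / (b + 1))) ^ 2 * b
        = - (a ^ 2 * (b + 2)) / (b + 1) ^ 2 := by field_simp; ring
    rw [e] at this
    have : 0 < a ^ 2 * (b + 2) / (b + 1) ^ 2 := by positivity
    rw [neg_div] at *
    linarith
  have hk : LinearMap.ker (S : Euc n →ₗ[ℝ] Euc n) = ⊥ := by
    by_contra hk
    exact hd (LinearMap.det_eq_zero_iff_ker_ne_bot.2 hk)
  exact (LinearMap.ker_eq_bot'.1 hk) v hz

lemma grad_inj_of_det {n : ℕ} {φ : Euc n → ℝ} (hφ : ContDiff ℝ 2 φ) (hc : ConvexOn ℝ univ φ)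
    (x y : Euc n) (hd : (fderiv ℝ (gradient φ) x).det ≠ 0) (h : gradient φ x = gradient φ y) :
    x = y := by
  set v := y - x with hv
  have hmono : ∀ s t : ℝ, s ≤ t → ⟪gradient φ (x + s • v), v⟫ ≤ ⟪gradient φ (x + t • v), v⟫ := by
    intro s t hst
    rcases hst.eq_or_lt with rfl | hlt
    · exact le_rfl
    have := conv_mono hφ hc (x + s • v) (x + t • v)
    have e : (x + t • v) - (x + s • v) = (t - s) • v := by rw [sub_smul]; abel
    rw [e, inner_smul_right, inner_sub_left] at this
    have h3 := nonneg_of_mul_nonneg_right this (sub_pos.2 hlt)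
    linarith
  have hconst : ∀ t ∈ Icc (0 : ℝ) 1, ⟪gradient φ (x + t • v), v⟫ = ⟪gradient φ x, v⟫ := by
    intro t ht
    have h0 := hmono 0 t ht.1
    have h1 := hmono t 1 ht.2
    have e1 : x + (1 : ℝ) • v = y := by simp [hv]
    rw [e1, ← h] at h1
    rw [zero_smul, add_zero] at h0
    linarith
  have hder := line_deriv2 hφ x v 0
  rw [zero_smul, add_zero] at hder
  have h1 : HasDerivWithinAt (fun t : ℝ => ⟪gradient φ (x + t • v), v⟫) (hess φ x v) (Icc 0 1) 0 :=
    hder.hasDerivWithinAt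
  have h2 : HasDerivWithinAt (fun t : ℝ => ⟪gradient φ (x + t • v), v⟫) 0 (Icc 0 1) 0 := by
    refine (hasDerivWithinAt_const (0 : ℝ) (Icc (0 : ℝ) 1) ⟪gradient φ x, v⟫).congr hconst ?_
    simp
  have h3 : hess φ x v = 0 :=
    (uniqueDiffOn_Icc (zero_lt_one (α := ℝ)) 0 (left_mem_Icc.2 zero_le_one)).eq_deriv _ h1 h2
  have hz : v = 0 := by
    apply psd_zero (fderiv ℝ (gradient φ) x) (hess_symm hφ x) _ hd
    · rw [← hess_eq hφ]; exact h3
    · intro w; rw [← hess_eq hφ]; exact conv_hess hφ hc x w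
  rw [hv, sub_eq_zero] at hz
  exact hz.symm

lemma monge_ampere {n : ℕ} {φ : Euc n → ℝ} (hφ : ContDiff ℝ 2 φ) (hc : ConvexOn ℝ univ φ)
    (r s : Euc n → ℝ) (hr : Continuous r) (hs : Continuous s) (hr0 : ∀ x, 0 < r x)
    (hs0 : ∀ x, 0 < s x)
    (hpush : Measure.map (fun x => gradient φ x) (volume.withDensity fun x => ENNReal.ofReal (r x))
      = volume.withDensity fun x => ENNReal.ofReal (s x)) (x : Euc n) :
    r x = s (gradient φ x) * (fderiv ℝ (gradient φ) x).det := by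
  set T := gradient φ with hT
  have hT1 : ContDiff ℝ 1 T := grad_contDiff hφ
  have hTc : Continuous T := hT1.continuous
  have hTd : ∀ x, HasFDerivAt T (fderiv ℝ T x) x := fun x =>
    (hT1.differentiable (by norm_num) x).hasFDerivAt
  have hdetc : Continuous (fun x => (fderiv ℝ T x).det) :=
    ContinuousLinearMap.continuous_det.comp (hT1.continuous_fderiv (by norm_num))
  have hdet0 : ∀ x, 0 ≤ (fderiv ℝ T x).det := fun x =>
    det_nonneg_of_psd _ (hess_symm hφ x) (fun v => by rw [← hess_eq hφ]; exact conv_hess hφ hc x v)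
  have hrm : Measurable (fun x => ENNReal.ofReal (r x)) := hr.measurable.ennreal_ofReal
  have hsm : Measurable (fun x => ENNReal.ofReal (s x)) := hs.measurable.ennreal_ofReal
  set μ := (volume : Measure (Euc n)).withDensity fun x => ENNReal.ofReal (r x) with hμ
  set ν := (volume : Measure (Euc n)).withDensity fun x => ENNReal.ofReal (s x) with hν
  set Z := {x | (fderiv ℝ T x).det = 0} with hZ
  have hZc : IsClosed Z := isClosed_eq hdetc continuous_const
  have hZm : MeasurableSet Z := hZc.measurableSet
  have hTZ : volume (T '' Z) = 0 :=
    addHaar_image_eq_zero_of_det_fderivWithin_eq_zero volume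
      (fun x _ => (hTd x).hasFDerivWithinAt) (fun x hx => hx)
  have hνTZ : ν (T '' Z) = 0 := withDensity_absolutelyContinuous _ _ hTZ
  have hμZ : μ Z = 0 := by
    have h1 : μ (T ⁻¹' (T '' Z)) ≤ Measure.map T μ (T '' Z) :=
      Measure.le_map_apply hTc.measurable.aemeasurable _
    have h2 : Measure.map T μ (T '' Z) = 0 := by
      have : Measure.map T μ = ν := hpush
      rw [this]; exact hνTZ
    rw [h2] at h1
    exact measure_mono_null (subset_preimage_image T Z) (le_antisymm h1 (zero_le))
  have hvZ : volume Z = 0 := by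
    rw [hμ, withDensity_apply_eq_zero' hrm.aemeasurable] at hμZ
    refine measure_mono_null ?_ hμZ
    intro y hy
    refine ⟨?_, hy⟩
    simp [hr0 y]
  have hae : (fun x => ENNReal.ofReal (r x)) =ᵐ[volume]
      fun x => ENNReal.ofReal |(fderiv ℝ T x).det| * ENNReal.ofReal (s (T x)) := by
    apply ae_eq_of_forall_setLIntegral_eq_of_sigmaFinite hrm
    · exact (hdetc.abs.measurable.ennreal_ofReal).mul (hsm.comp hTc.measurable)
    intro S hS _
    have hS' : MeasurableSet (S \ Z) := hS.diff hZm
    have hSe : (S \ Z : Set (Euc n)) =ᵐ[volume] S := sdiff_null_ae_eq_self hvZ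
    rw [← setLIntegral_congr hSe, ← setLIntegral_congr hSe]
    have hinj : ∀ x ∈ S \ Z, ∀ y, T x = T y → x = y := fun x hx y hxy =>
      grad_inj_of_det hφ hc x y hx.2 hxy
    have hinj' : InjOn T (S \ Z) := fun x hx y _ hxy => hinj x hx y hxy
    have him : MeasurableSet (T '' (S \ Z)) :=
      measurable_image_of_fderivWithin hS' (fun x _ => (hTd x).hasFDerivWithinAt) hinj'
    have hpre : T ⁻¹' (T '' (S \ Z)) = S \ Z := by
      apply Subset.antisymm _ (subset_preimage_image T _)
      rintro y ⟨x, hx, hxy⟩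
      rw [← hinj x hx y hxy]; exact hx
    rw [← lintegral_image_eq_lintegral_abs_det_fderiv_mul volume hS'
      (fun x _ => (hTd x).hasFDerivWithinAt) hinj' (fun y => ENNReal.ofReal (s y))]
    rw [← withDensity_apply _ hS', ← withDensity_apply _ him, ← hμ, ← hν, ← hpush,
      Measure.map_apply hTc.measurable him, hpre]
  have hae2 : r =ᵐ[volume] fun x => s (T x) * (fderiv ℝ T x).det := by
    filter_upwards [hae] with y hy
    rw [← ENNReal.ofReal_mul (abs_nonneg _), abs_of_nonneg (hdet0 y)] at hy
    have := (ENNReal.ofReal_eq_ofReal_iff (hr0 y).le (mul_nonneg (hdet0 y) (hs0 _).le)).1 hy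
    rw [this, mul_comm]
  have := (Continuous.ae_eq_iff_eq volume hr ((hs.comp hTc).mul hdetc)).1 hae2
  exact congrFun this x

lemma radial_integrable {n : ℕ} (hn : 1 ≤ n) (p ρ : ℝ) (hp : (n : ℝ) ≤ p) (hρ : 0 < ρ) :
    Integrable (fun x : Euc n => (Ioi ρ).indicator (fun t : ℝ => t ^ (-(2 * p))) ‖x‖) := by
  have : Nontrivial (Euc n) := by
    have : Nonempty (Fin n) := ⟨⟨0, hn⟩⟩
    infer_instance
  have hn' : (1 : ℝ) ≤ n := by exact_mod_cast hn
  rw [integrable_fun_norm_addHaar volume (f := (Ioi ρ).indicator (fun t : ℝ => t ^ (-(2 * p))))]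
  have h1 : IntegrableOn (fun t : ℝ => t ^ ((n : ℝ) - 1 - 2 * p)) (Ioi ρ) :=
    integrableOn_Ioi_rpow_of_lt (by linarith) hρ
  have h2 : Integrable ((Ioi ρ).indicator (fun t : ℝ => t ^ ((n : ℝ) - 1 - 2 * p))) :=
    (integrable_indicator_iff measurableSet_Ioi).2 h1
  refine (h2.integrableOn (s := Ioi 0)).congr_fun ?_ measurableSet_Ioi
  intro y hy
  simp only [finrank_euclideanSpace, Fintype.card_fin, smul_eq_mul]
  by_cases hyρ : y ∈ Ioi ρ
  · simp only [indicator_of_mem hyρ]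
    rw [← Real.rpow_natCast, ← Real.rpow_add hy, Nat.cast_sub hn]
    congr 1; push_cast; ring
  · simp [indicator_of_notMem hyρ]

lemma radial_integral {n : ℕ} (hn : 1 ≤ n) (p ρ : ℝ) (hp : (n : ℝ) ≤ p) (hρ : 0 < ρ) :
    ∫ x : Euc n, (Ioi ρ).indicator (fun t : ℝ => t ^ (-(2 * p))) ‖x‖
      ≤ volume.real (ball (0 : Euc n) 1) * ρ ^ ((n : ℝ) - 2 * p) := by
  have : Nontrivial (Euc n) := by
    have : Nonempty (Fin n) := ⟨⟨0, hn⟩⟩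
    infer_instance
  have hn' : (1 : ℝ) ≤ n := by exact_mod_cast hn
  rw [integral_fun_norm_addHaar volume ((Ioi ρ).indicator (fun t : ℝ => t ^ (-(2 * p))))]
  have h1 : ∫ y in Ioi (0 : ℝ), y ^ (Module.finrank ℝ (Euc n) - 1) •
      (Ioi ρ).indicator (fun t : ℝ => t ^ (-(2 * p))) y
      = ∫ y in Ioi (0 : ℝ), (Ioi ρ).indicator (fun t : ℝ => t ^ ((n : ℝ) - 1 - 2 * p)) y := by
    refine setIntegral_congr_fun measurableSet_Ioi ?_
    intro y hy
    simp only [finrank_euclideanSpace, Fintype.card_fin, smul_eq_mul]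
    by_cases hyρ : y ∈ Ioi ρ
    · simp only [indicator_of_mem hyρ]
      rw [← Real.rpow_natCast, ← Real.rpow_add hy, Nat.cast_sub hn]
      congr 1; push_cast; ring
    · simp [indicator_of_notMem hyρ]
  rw [h1, setIntegral_indicator measurableSet_Ioi]
  have h2 : Ioi (0 : ℝ) ∩ Ioi ρ = Ioi ρ := inter_eq_right.2 (Ioi_subset_Ioi hρ.le)
  rw [h2, integral_Ioi_rpow_of_lt (by linarith) hρ]
  simp only [finrank_euclideanSpace, Fintype.card_fin, smul_eq_mul, nsmul_eq_mul]
  have e : (n : ℝ) - 1 - 2 * p + 1 = (n : ℝ) - 2 * p := by ring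
  rw [e]
  have hω : 0 ≤ volume.real (ball (0 : Euc n) 1) := measureReal_nonneg
  have hr : 0 ≤ ρ ^ ((n : ℝ) - 2 * p) := Real.rpow_nonneg hρ.le _
  have e2 : (n : ℝ) * (volume.real (ball (0 : Euc n) 1) * (-ρ ^ ((n : ℝ) - 2 * p) / ((n : ℝ) - 2 * p)))
      = (volume.real (ball (0 : Euc n) 1) * ρ ^ ((n : ℝ) - 2 * p)) * (n / (2 * p - n)) := by
    have : (n : ℝ) - 2 * p ≠ 0 := by linarith
    have : 2 * p - (n : ℝ) ≠ 0 := by linarith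
    have e3 : (n : ℝ) - 2 * p = -(2 * p - n) := by ring
    rw [e3]
    generalize ρ ^ (-(2 * p - (n : ℝ))) = z
    field_simp
  rw [e2]
  apply mul_le_of_le_one_right (mul_nonneg hω hr)
  rw [div_le_one (by linarith)]; linarith

/-- two-sided comparison data for a potential -/
structure Comp (n : ℕ) (U : Euc n → ℝ) (p c C : ℝ) : Prop where
  hn : 1 ≤ n
  hp : (n : ℝ) ≤ p
  hU : Continuous U
  hc : 0 < c
  hC : 0 < C
  hlow : ∀ x, c * (p + ‖x‖ ^ 2) ≤ p + U x
  hup : ∀ x, p + U x ≤ C * (p + ‖x‖ ^ 2)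
  hZfin : Integrable fun x : Euc n => (1 + U x / p) ^ (-p)

namespace Comp
variable {n : ℕ} {U : Euc n → ℝ} {p c C : ℝ}

lemma p_pos (h : Comp n U p c C) : 0 < p := by
  have := h.hp
  have : (1 : ℝ) ≤ n := by exact_mod_cast h.hn
  linarith

lemma low (h : Comp n U p c C) (x : Euc n) : c * (1 + ‖x‖ ^ 2 / p) ≤ 1 + U x / p := by
  have hp := h.p_pos
  have := h.hlow x
  have e1 : c * (1 + ‖x‖ ^ 2 / p) = c * (p + ‖x‖ ^ 2) / p := by field_simp
  have e2 : 1 + U x / p = (p + U x) / p := by field_simp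
  rw [e1, e2]; gcongr

lemma up (h : Comp n U p c C) (x : Euc n) : 1 + U x / p ≤ C * (1 + ‖x‖ ^ 2 / p) := by
  have hp := h.p_pos
  have := h.hup x
  have e1 : C * (1 + ‖x‖ ^ 2 / p) = C * (p + ‖x‖ ^ 2) / p := by field_simp
  have e2 : 1 + U x / p = (p + U x) / p := by field_simp
  rw [e1, e2]; gcongr

lemma pos (h : Comp n U p c C) (x : Euc n) : 0 < 1 + U x / p := by
  have hp := h.p_pos
  have hc := h.hc
  exact lt_of_lt_of_le (by positivity) (h.low x)

lemma u_up (h : Comp n U p c C) (x : Euc n) :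
    (1 + U x / p) ^ (-p) ≤ c ^ (-p) * (1 + ‖x‖ ^ 2 / p) ^ (-p) := by
  have hp := h.p_pos
  have hc := h.hc
  rw [← Real.mul_rpow hc.le (by positivity)]
  exact Real.rpow_le_rpow_of_nonpos (by positivity) (h.low x) (by linarith)

lemma u_low (h : Comp n U p c C) (x : Euc n) :
    C ^ (-p) * (1 + ‖x‖ ^ 2 / p) ^ (-p) ≤ (1 + U x / p) ^ (-p) := by
  have hp := h.p_pos
  rw [← Real.mul_rpow h.hC.le (by positivity)]
  exact Real.rpow_le_rpow_of_nonpos (h.pos x) (h.up x) (by linarith)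

lemma tail (h : Comp n U p c C) (ρ : ℝ) (hρ : 0 < ρ) :
    ∫ x in {x : Euc n | ρ < ‖x‖}, (1 + U x / p) ^ (-p)
      ≤ c ^ (-p) * (volume.real (ball (0 : Euc n) 1) * (p ^ p * ρ ^ ((n : ℝ) - 2 * p))) := by
  have hp := h.p_pos
  have hc := h.hc
  have hm : MeasurableSet {x : Euc n | ρ < ‖x‖} := measurableSet_lt measurable_const measurable_norm
  have hri := radial_integrable h.hn p ρ h.hp hρ
  calc ∫ x in {x : Euc n | ρ < ‖x‖}, (1 + U x / p) ^ (-p)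
      = ∫ x, {x : Euc n | ρ < ‖x‖}.indicator (fun x => (1 + U x / p) ^ (-p)) x :=
        (integral_indicator hm).symm
    _ ≤ ∫ x : Euc n, (c ^ (-p) * p ^ p) * (Ioi ρ).indicator (fun t : ℝ => t ^ (-(2 * p))) ‖x‖ := by
        apply integral_mono (h.hZfin.indicator hm) (hri.const_mul _)
        intro x
        by_cases hx : ρ < ‖x‖
        · have hx0 : 0 < ‖x‖ := hρ.trans hx
          have hm1 : x ∈ {x : Euc n | ρ < ‖x‖} := hx
          have hm2 : ‖x‖ ∈ Ioi ρ := hx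
          simp only [indicator_of_mem hm1, indicator_of_mem hm2]
          refine (h.u_up x).trans ?_
          rw [mul_assoc]
          apply mul_le_mul_of_nonneg_left _ (Real.rpow_nonneg hc.le _)
          have : (1 + ‖x‖ ^ 2 / p) ^ (-p) ≤ (‖x‖ ^ 2 / p) ^ (-p) :=
            Real.rpow_le_rpow_of_nonpos (by positivity) (by linarith) (by linarith)
          refine this.trans (le_of_eq ?_)
          rw [Real.div_rpow (by positivity) hp.le, Real.rpow_neg hp.le p, div_inv_eq_mul, mul_comm,
            ← Real.rpow_natCast, ← Real.rpow_mul hx0.le]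
          congr 2; push_cast; ring
        · have hm1 : x ∉ {x : Euc n | ρ < ‖x‖} := hx
          have hm2 : ‖x‖ ∉ Ioi ρ := hx
          simp [indicator_of_notMem hm1, indicator_of_notMem hm2]
    _ ≤ _ := by
        rw [integral_const_mul]
        have := radial_integral h.hn p ρ h.hp hρ
        calc _ ≤ (c ^ (-p) * p ^ p) * (volume.real (ball (0 : Euc n) 1) * ρ ^ ((n : ℝ) - 2 * p)) := by
              gcongr
          _ = _ := by ring

lemma omega_pos (n : ℕ) : 0 < volume.real (ball (0 : Euc n) 1) :=
  ENNReal.toReal_pos (measure_ball_pos volume _ one_pos).ne' measure_ball_lt_top.ne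

lemma sqrt_pow_eq (hp : 0 < p) (n : ℕ) : Real.sqrt p ^ n = p ^ ((n : ℝ) / 2) := by
  rw [Real.sqrt_eq_rpow, ← Real.rpow_natCast, ← Real.rpow_mul hp.le]
  congr 1; ring

lemma Z_up (h : Comp n U p c C) :
    Znorm U p ≤ 2 * c ^ (-p) * (volume.real (ball (0 : Euc n) 1) * p ^ ((n : ℝ) / 2)) := by
  have hp := h.p_pos
  have hc := h.hc
  have hsp : 0 < Real.sqrt p := Real.sqrt_pos.2 hp
  have hm : MeasurableSet (closedBall (0 : Euc n) (Real.sqrt p)) := measurableSet_closedBall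
  have hcomp : (closedBall (0 : Euc n) (Real.sqrt p))ᶜ = {x : Euc n | Real.sqrt p < ‖x‖} := by
    ext x; simp
  rw [Znorm, ← integral_add_compl hm h.hZfin, hcomp]
  have h1 := h.tail _ hsp
  have h2 : ∫ x in closedBall (0 : Euc n) (Real.sqrt p), (1 + U x / p) ^ (-p)
      ≤ c ^ (-p) * (volume.real (ball (0 : Euc n) 1) * p ^ ((n : ℝ) / 2)) := by
    calc ∫ x in closedBall (0 : Euc n) (Real.sqrt p), (1 + U x / p) ^ (-p)
        ≤ ∫ x in closedBall (0 : Euc n) (Real.sqrt p), c ^ (-p) := by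
          apply setIntegral_mono_on h.hZfin.integrableOn _ hm
          · intro x _
            refine (h.u_up x).trans ?_
            apply mul_le_of_le_one_right (Real.rpow_nonneg hc.le _)
            apply Real.rpow_le_one_of_one_le_of_nonpos _ (by linarith)
            have : 0 ≤ ‖x‖ ^ 2 / p := by positivity
            linarith
          · exact integrableOn_const measure_closedBall_lt_top.ne
      _ = _ := by
          rw [setIntegral_const, Measure.addHaar_real_closedBall _ _ hsp.le, smul_eq_mul]
          simp only [finrank_euclideanSpace, Fintype.card_fin]
          rw [sqrt_pow_eq hp]; ring
  have e : p ^ p * Real.sqrt p ^ ((n : ℝ) - 2 * p) = p ^ ((n : ℝ) / 2) := by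
    rw [Real.sqrt_eq_rpow, ← Real.rpow_mul hp.le, ← Real.rpow_add hp]
    congr 1; ring
  rw [e] at h1
  linarith

lemma Z_low (h : Comp n U p c C) :
    (2 * C) ^ (-p) * (volume.real (ball (0 : Euc n) 1) * p ^ ((n : ℝ) / 2)) ≤ Znorm U p := by
  have hp := h.p_pos
  have hC := h.hC
  have hsp : 0 < Real.sqrt p := Real.sqrt_pos.2 hp
  have hm : MeasurableSet (closedBall (0 : Euc n) (Real.sqrt p)) := measurableSet_closedBall
  calc (2 * C) ^ (-p) * (volume.real (ball (0 : Euc n) 1) * p ^ ((n : ℝ) / 2))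
      = ∫ x in closedBall (0 : Euc n) (Real.sqrt p), (2 * C) ^ (-p) := by
          rw [setIntegral_const, Measure.addHaar_real_closedBall _ _ hsp.le, smul_eq_mul]
          simp only [finrank_euclideanSpace, Fintype.card_fin]
          rw [sqrt_pow_eq hp]; ring
    _ ≤ ∫ x in closedBall (0 : Euc n) (Real.sqrt p), (1 + U x / p) ^ (-p) := by
          apply setIntegral_mono_on _ h.hZfin.integrableOn hm
          · intro x hx
            refine Real.rpow_le_rpow_of_nonpos (h.pos x) ((h.up x).trans ?_) (by linarith)
            rw [mul_comm 2 C]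
            apply mul_le_mul_of_nonneg_left _ hC.le
            have hx' : ‖x‖ ≤ Real.sqrt p := by simpa using hx
            have : ‖x‖ ^ 2 ≤ p := by
              rw [← Real.sq_sqrt hp.le]; gcongr
            have : ‖x‖ ^ 2 / p ≤ 1 := (div_le_one hp).2 this
            linarith
          · exact integrableOn_const measure_closedBall_lt_top.ne
    _ ≤ _ := by
          rw [Znorm]
          exact setIntegral_le_integral h.hZfin
            (Filter.Eventually.of_forall fun x => Real.rpow_nonneg (h.pos x).le _)

lemma Z_pos (h : Comp n U p c C) : 0 < Znorm U p := by
  have hp := h.p_pos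
  have hC := h.hC
  have := omega_pos n
  exact lt_of_lt_of_le (by positivity) h.Z_low

lemma mu_real (h : Comp n U p c C) {S : Set (Euc n)} (hS : MeasurableSet S) :
    (muUP U p).real S = (Znorm U p)⁻¹ * ∫ x in S, (1 + U x / p) ^ (-p) := by
  have hZ := h.Z_pos
  rw [muUP, Measure.real, withDensity_apply _ hS, ← integral_const_mul,
    ← ofReal_integral_eq_lintegral_ofReal, ENNReal.toReal_ofReal]
  · apply integral_nonneg
    intro x
    exact mul_nonneg (inv_nonneg.2 hZ.le) (Real.rpow_nonneg (h.pos x).le _)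
  · exact (h.hZfin.const_mul _).integrableOn
  · refine Filter.Eventually.of_forall fun x => ?_
    exact mul_nonneg (inv_nonneg.2 hZ.le) (Real.rpow_nonneg (h.pos x).le _)

lemma finite (h : Comp n U p c C) : IsFiniteMeasure (muUP U p) := by
  apply isFiniteMeasure_withDensity_ofReal
  exact (h.hZfin.const_mul _).2

lemma mu_tail (h : Comp n U p c C) (ρ : ℝ) (hρ : 0 < ρ) :
    (muUP U p).real {x : Euc n | ρ < ‖x‖} ≤ (C / c) ^ p * 2 ^ p * (p / ρ ^ 2) ^ (p - (n : ℝ) / 2) := by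
  have hp := h.p_pos
  have hc := h.hc
  have hC := h.hC
  have hZ := h.Z_pos
  have hω := omega_pos n
  rw [h.mu_real (measurableSet_lt measurable_const measurable_norm), inv_mul_le_iff₀ hZ]
  refine (h.tail ρ hρ).trans ?_
  refine le_trans (le_of_eq ?_) (mul_le_mul_of_nonneg_right h.Z_low (by positivity))
  have e1 : ρ ^ ((n : ℝ) - 2 * p) = ((ρ ^ 2) ^ (p - (n : ℝ) / 2))⁻¹ := by
    rw [← Real.rpow_natCast ρ 2, ← Real.rpow_mul hρ.le, ← Real.rpow_neg hρ.le]
    congr 1; push_cast; ring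
  have e2 : p ^ p = p ^ (p - (n : ℝ) / 2) * p ^ ((n : ℝ) / 2) := by
    rw [← Real.rpow_add hp]; congr 1; ring
  rw [e1, e2, Real.div_rpow hp.le (by positivity), Real.div_rpow hC.le hc.le,
    Real.mul_rpow (by norm_num) hC.le, Real.rpow_neg hc.le, Real.rpow_neg hC.le,
    Real.rpow_neg (by norm_num)]
  have a1 : 0 < C ^ p := by positivity
  have a2 : (0 : ℝ) < 2 ^ p := by positivity
  have a3 : (0 : ℝ) < c ^ p := by positivity
  have a4 : (0 : ℝ) < (ρ ^ 2) ^ (p - (n : ℝ) / 2) := by positivity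
  generalize (2 : ℝ) ^ p = X at *
  field_simp

lemma mu_ball (h : Comp n U p c C) (x0 u : Euc n) (hu : ‖u‖ = 1) (t : ℝ)
    (ht : t = Real.sqrt (p + ‖x0‖ ^ 2)) :
    (C / c) ^ (-p) * 10 ^ (-p) * (1 / 2) * (1 / 2) ^ n * (1 + ‖x0‖ ^ 2 / p) ^ (-(p - (n : ℝ) / 2)) ≤
      (muUP U p).real (ball (x0 + t • u) (t / 2)) := by
  have hp := h.p_pos
  have hc := h.hc
  have hC := h.hC
  have hZ := h.Z_pos
  have hω := omega_pos n
  have ht2 : t ^ 2 = p + ‖x0‖ ^ 2 := by rw [ht, Real.sq_sqrt (by positivity)]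
  have ht0 : 0 < t := by rw [ht]; exact Real.sqrt_pos.2 (by positivity)
  set S := 1 + ‖x0‖ ^ 2 / p with hS
  have hS0 : 0 < S := by positivity
  have htS : t = Real.sqrt p * Real.sqrt S := by
    rw [ht, ← Real.sqrt_mul hp.le]; congr 1; rw [hS]; field_simp
  have h1 : C ^ (-p) * (10 * S) ^ (-p) * ((t / 2) ^ n * volume.real (ball (0 : Euc n) 1))
      ≤ ∫ x in ball (x0 + t • u) (t / 2), (1 + U x / p) ^ (-p) := by
    calc C ^ (-p) * (10 * S) ^ (-p) * ((t / 2) ^ n * volume.real (ball (0 : Euc n) 1))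
        = ∫ x in ball (x0 + t • u) (t / 2), C ^ (-p) * (10 * S) ^ (-p) := by
          have hb : volume.real (ball (x0 + t • u) (t / 2)) =
              (t / 2) ^ n * volume.real (ball (0 : Euc n) 1) := by
            rw [Measure.real, Measure.addHaar_ball_of_pos _ _ (by positivity), ENNReal.toReal_mul,
              ENNReal.toReal_ofReal (by positivity)]
            simp only [finrank_euclideanSpace, Fintype.card_fin]
            rfl
          rw [setIntegral_const, hb, smul_eq_mul]
          ring
      _ ≤ _ := by
          apply setIntegral_mono_on _ h.hZfin.integrableOn measurableSet_ball
          · intro x hx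
            refine le_trans ?_ (h.u_low x)
            apply mul_le_mul_of_nonneg_left _ (Real.rpow_nonneg hC.le _)
            refine Real.rpow_le_rpow_of_nonpos (by positivity) ?_ (by linarith)
            have hx1 : ‖x - (x0 + t • u)‖ < t / 2 := by simpa [dist_eq_norm] using hx
            have hx2 : ‖x‖ ≤ ‖x0‖ + 2 * t := by
              calc ‖x‖ = ‖(x - (x0 + t • u)) + (x0 + t • u)‖ := by congr 1; abel
                _ ≤ ‖x - (x0 + t • u)‖ + (‖x0‖ + ‖t • u‖) :=
                  (norm_add_le _ _).trans (by gcongr; exact norm_add_le _ _)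
                _ ≤ _ := by rw [norm_smul, hu, Real.norm_of_nonneg ht0.le]; linarith
            have hx3 : ‖x‖ ^ 2 ≤ 10 * ‖x0‖ ^ 2 + 9 * p := by
              have : ‖x‖ ^ 2 ≤ (‖x0‖ + 2 * t) ^ 2 := by gcongr
              nlinarith [sq_nonneg (‖x0‖ - 2 * t), sq_nonneg (2 * ‖x0‖ - t), ht2]
            have : 1 + ‖x‖ ^ 2 / p ≤ 1 + (10 * ‖x0‖ ^ 2 + 9 * p) / p := by gcongr
            refine this.trans (le_of_eq ?_)
            rw [hS]; field_simp; ring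
          · exact integrableOn_const measure_ball_lt_top.ne
  rw [h.mu_real measurableSet_ball, le_inv_mul_iff₀ hZ]
  refine le_trans ?_ h1
  refine (mul_le_mul_of_nonneg_right h.Z_up (by positivity)).trans (le_of_eq ?_)
  have e3 : (t / 2) ^ n = p ^ ((n : ℝ) / 2) * S ^ ((n : ℝ) / 2) * (1 / 2) ^ n := by
    rw [htS, ← sqrt_pow_eq hp, ← sqrt_pow_eq hS0, ← mul_pow, ← mul_pow]; congr 1; ring
  have e2 : S ^ (-(p - (n : ℝ) / 2)) = S ^ (-p) * S ^ ((n : ℝ) / 2) := by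
    rw [← Real.rpow_add hS0]; congr 1; ring
  rw [e2, e3, Real.div_rpow hC.le hc.le, Real.mul_rpow (by norm_num) hS0.le]
  have a3 : (0 : ℝ) < c ^ (-p) := by positivity
  generalize (10 : ℝ) ^ (-p) = X at *
  generalize c ^ (-p) = X2 at *
  generalize C ^ (-p) = X3 at *
  field_simp

end Comp

lemma geom_cone {n : ℕ} (x0 y0 x y : Euc n) (h : 0 ≤ ⟪y - y0, x - x0⟫) (t : ℝ) (ht : 0 < t)
    (hx : x ∈ ball (x0 + t • (‖y0‖⁻¹ • y0)) (t / 2)) (hy0 : y0 ≠ 0) : ‖y0‖ / 3 < ‖y‖ := by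
  have hR : 0 < ‖y0‖ := norm_pos_iff.2 hy0
  set e := x - (x0 + t • (‖y0‖⁻¹ • y0)) with he
  have he1 : ‖e‖ < t / 2 := by simpa [dist_eq_norm] using hx
  have hxx : x - x0 = t • (‖y0‖⁻¹ • y0) + e := by rw [he]; abel
  have hu : ‖‖y0‖⁻¹ • y0‖ = 1 := by rw [norm_smul, norm_inv, norm_norm, inv_mul_cancel₀ hR.ne']
  have h1 : ‖x - x0‖ ≤ 3 * t / 2 := by
    rw [hxx]
    refine (norm_add_le _ _).trans ?_
    rw [norm_smul, hu, Real.norm_of_nonneg ht.le]; linarith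
  have h2 : ⟪y0, x - x0⟫ = t * ‖y0‖ + ⟪y0, e⟫ := by
    rw [hxx, inner_add_right, inner_smul_right, inner_smul_right, real_inner_self_eq_norm_sq]
    field_simp
  have h3 : -(‖y0‖ * ‖e‖) ≤ ⟪y0, e⟫ := by
    have := abs_real_inner_le_norm y0 e
    linarith [neg_abs_le ⟪y0, e⟫]
  have h4 : ⟪y, x - x0⟫ ≤ ‖y‖ * ‖x - x0‖ := real_inner_le_norm _ _
  rw [inner_sub_left] at h
  have h5 : ‖y‖ * ‖x - x0‖ ≤ ‖y‖ * (3 * t / 2) := by gcongr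
  have h6 : ‖y0‖ * ‖e‖ < ‖y0‖ * (t / 2) := by gcongr
  nlinarith

lemma growth_raw1 {n : ℕ} {V W : Euc n → ℝ} {d D cv Cv cw Cw : ℝ} (hV : Comp n V d cv Cv)
    (hW : Comp n W D cw Cw) {φ : Euc n → ℝ} (hφ : ContDiff ℝ 2 φ) (hc : ConvexOn ℝ univ φ)
    (hpush : Measure.map (fun x => gradient φ x) (muUP V d) = muUP W D) (x : Euc n)
    (hx : gradient φ x ≠ 0) :
    (Cv / cv) ^ (-d) * 10 ^ (-d) * (1 / 2) * (1 / 2) ^ n * (1 + ‖x‖ ^ 2 / d) ^ (-(d - (n : ℝ) / 2))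
      ≤ (Cw / cw) ^ D * 2 ^ D * (D / (‖gradient φ x‖ / 3) ^ 2) ^ (D - (n : ℝ) / 2) := by
  have hR : 0 < ‖gradient φ x‖ := norm_pos_iff.2 hx
  have hu : ‖‖gradient φ x‖⁻¹ • gradient φ x‖ = 1 := by
    rw [norm_smul, norm_inv, norm_norm, inv_mul_cancel₀ hR.ne']
  have hd := hV.p_pos
  have := hV.finite
  have := hW.finite
  have hT : Measurable (fun x => gradient φ x) := (grad_contDiff hφ).continuous.measurable
  have hS : MeasurableSet {y : Euc n | ‖gradient φ x‖ / 3 < ‖y‖} :=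
    measurableSet_lt measurable_const measurable_norm
  refine (hV.mu_ball x _ hu _ rfl).trans (le_trans ?_ (hW.mu_tail (‖gradient φ x‖ / 3) (by positivity)))
  rw [← hpush, map_measureReal_apply hT hS]
  apply measureReal_mono _ (measure_ne_top _ _)
  intro z hz
  exact geom_cone x (gradient φ x) z _ (conv_mono hφ hc x z) _ (Real.sqrt_pos.2 (by positivity)) hz hx

lemma growth_raw2 {n : ℕ} {V W : Euc n → ℝ} {d D cv Cv cw Cw : ℝ} (hV : Comp n V d cv Cv)
    (hW : Comp n W D cw Cw) {φ : Euc n → ℝ} (hφ : ContDiff ℝ 2 φ) (hc : ConvexOn ℝ univ φ)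
    (hpush : Measure.map (fun x => gradient φ x) (muUP V d) = muUP W D) (x : Euc n)
    (hx : x ≠ 0) :
    (Cw / cw) ^ (-D) * 10 ^ (-D) * (1 / 2) * (1 / 2) ^ n *
        (1 + ‖gradient φ x‖ ^ 2 / D) ^ (-(D - (n : ℝ) / 2))
      ≤ (Cv / cv) ^ d * 2 ^ d * (d / (‖x‖ / 3) ^ 2) ^ (d - (n : ℝ) / 2) := by
  have hR : 0 < ‖x‖ := norm_pos_iff.2 hx
  have hu : ‖‖x‖⁻¹ • x‖ = 1 := by
    rw [norm_smul, norm_inv, norm_norm, inv_mul_cancel₀ hR.ne']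
  have hd := hW.p_pos
  have := hV.finite
  have := hW.finite
  have hT : Measurable (fun x => gradient φ x) := (grad_contDiff hφ).continuous.measurable
  have h1 := hW.mu_ball (gradient φ x) _ hu _ rfl
  have h2 := hV.mu_tail (‖x‖ / 3) (by positivity)
  have ht : 0 < Real.sqrt (D + ‖gradient φ x‖ ^ 2) := Real.sqrt_pos.2 (by positivity)
  refine h1.trans (le_trans ?_ h2)
  rw [← hpush, map_measureReal_apply hT measurableSet_ball]
  apply measureReal_mono _ (measure_ne_top _ _)
  intro z hz
  have hm : 0 ≤ ⟪z - x, gradient φ z - gradient φ x⟫ := by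
    rw [real_inner_comm]; exact conv_mono hφ hc x z
  rw [mem_preimage] at hz
  exact geom_cone (gradient φ x) x (gradient φ z) z hm _ ht hz hx

lemma num_growth (k k' P m m' : ℝ) (hk : 0 < k) (hk' : 0 < k') (hP : 0 < P) (hm' : 0 < m') :
    ∃ K : ℝ, 0 < K ∧ ∀ r S : ℝ, 0 < r → 0 < S → k * S ^ (-m) ≤ k' * (P / (r / 3) ^ 2) ^ m' →
      r ≤ K * S ^ (m / (2 * m')) := by
  refine ⟨(k⁻¹ * k' * (9 * P) ^ m') ^ (1 / (2 * m')), by positivity, ?_⟩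
  intro r S hr hS h
  have e : P / (r / 3) ^ 2 = (9 * P) / r ^ 2 := by field_simp; ring
  have e2 : (r ^ 2) ^ m' = r ^ (2 * m') := by
    rw [← Real.rpow_natCast r 2, ← Real.rpow_mul hr.le]; congr 1
  rw [e, Real.div_rpow (by positivity) (by positivity), e2, Real.rpow_neg hS.le] at h
  have a1 : 0 < r ^ (2 * m') := by positivity
  have a2 : 0 < S ^ m := by positivity
  have h2 : r ^ (2 * m') ≤ (k⁻¹ * k' * (9 * P) ^ m') * S ^ m := by
    generalize (9 * P) ^ m' = Q at *
    rw [← mul_div_assoc, le_div_iff₀ a1] at h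
    have h3 := mul_le_mul_of_nonneg_left h (show 0 ≤ k⁻¹ * S ^ m by positivity)
    calc r ^ (2 * m') = k⁻¹ * S ^ m * (k * (S ^ m)⁻¹ * r ^ (2 * m')) := by field_simp
      _ ≤ _ := h3
      _ = _ := by ring
  have h3 := Real.rpow_le_rpow a1.le h2 (show 0 ≤ 1 / (2 * m') by positivity)
  rw [← Real.rpow_mul hr.le, Real.mul_rpow (by positivity) a2.le, ← Real.rpow_mul hS.le] at h3
  have e4 : 2 * m' * (1 / (2 * m')) = 1 := by field_simp
  have e5 : m * (1 / (2 * m')) = m / (2 * m') := by ring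
  rwa [e4, Real.rpow_one, e5] at h3

lemma one_add_sq_le {r p : ℝ} (hr : 0 ≤ r) (hp : 1 ≤ p) : 1 + r ^ 2 / p ≤ (1 + r) ^ 2 := by
  have : r ^ 2 / p ≤ r ^ 2 := div_le_self (by positivity) hp
  nlinarith

lemma growth_qual {n : ℕ} {V W : Euc n → ℝ} {d D cv Cv cw Cw : ℝ} (hV : Comp n V d cv Cv)
    (hW : Comp n W D cw Cw) (hdD : d ≤ D) {φ : Euc n → ℝ} (hφ : ContDiff ℝ 2 φ)
    (hc : ConvexOn ℝ univ φ)
    (hpush : Measure.map (fun x => gradient φ x) (muUP V d) = muUP W D) :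
    ∃ K α : ℝ, 0 < K ∧ 0 < α ∧ α ≤ 1 ∧ ∀ x : Euc n, ‖gradient φ x‖ ≤ K * (1 + ‖x‖) ^ α ∧
      (1 + ‖x‖) ^ α ≤ K * (1 + ‖gradient φ x‖) := by
  have hn1 : (1 : ℝ) ≤ n := by exact_mod_cast hV.hn
  have hd1 : 1 ≤ d := hn1.trans hV.hp
  have hD1 : 1 ≤ D := hd1.trans hdD
  have hnd := hV.hp
  have := hV.hc
  have := hV.hC
  have := hW.hc
  have := hW.hC
  have m1 : 0 < d - (n : ℝ) / 2 := by linarith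
  have m2 : 0 < D - (n : ℝ) / 2 := by linarith
  set md := d - (n : ℝ) / 2 with hmd
  set mD := D - (n : ℝ) / 2 with hmD
  obtain ⟨K1, hK1, h1⟩ := num_growth ((Cv / cv) ^ (-d) * 10 ^ (-d) * (1 / 2) * (1 / 2) ^ n)
    ((Cw / cw) ^ D * 2 ^ D) D md mD (by positivity) (by positivity) (by positivity) m2
  obtain ⟨K2, hK2, h2⟩ := num_growth ((Cw / cw) ^ (-D) * 10 ^ (-D) * (1 / 2) * (1 / 2) ^ n)
    ((Cv / cv) ^ d * 2 ^ d) d mD md (by positivity) (by positivity) (by positivity) m1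
  set α := md / mD with hα
  have hα0 : 0 < α := by positivity
  have hα1 : α ≤ 1 := by rw [hα, div_le_one m2]; linarith
  refine ⟨K1 + (1 + K2 ^ α), α, by positivity, hα0, hα1, fun x => ⟨?_, ?_⟩⟩
  · have hx1 : 0 < (1 + ‖x‖) ^ α := by positivity
    have goal' : ‖gradient φ x‖ ≤ K1 * (1 + ‖x‖) ^ α := by
      by_cases hx : gradient φ x = 0
      · rw [hx, norm_zero]; positivity
      · have := h1 ‖gradient φ x‖ (1 + ‖x‖ ^ 2 / d) (norm_pos_iff.2 hx) (by positivity)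
          (growth_raw1 hV hW hφ hc hpush x hx)
        refine this.trans ?_
        gcongr
        calc (1 + ‖x‖ ^ 2 / d) ^ (md / (2 * mD)) ≤ ((1 + ‖x‖) ^ 2) ^ (md / (2 * mD)) := by
              gcongr; exact one_add_sq_le (norm_nonneg _) hd1
          _ = (1 + ‖x‖) ^ α := by
              rw [← Real.rpow_natCast, ← Real.rpow_mul (by positivity)]; congr 1
              rw [hα]; push_cast; field_simp
    have : 0 ≤ (1 + K2 ^ α) * (1 + ‖x‖) ^ α := by positivity
    linarith
  · have goal' : (1 + ‖x‖) ^ α ≤ (1 + K2 ^ α) * (1 + ‖gradient φ x‖) := by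
      have s1 : (1 + ‖x‖) ^ α ≤ 1 + ‖x‖ ^ α := by
        have := Real.rpow_add_le_add_rpow zero_le_one (norm_nonneg x) hα0.le hα1
        rwa [Real.one_rpow] at this
      have s2 : ‖x‖ ^ α ≤ K2 ^ α * (1 + ‖gradient φ x‖) := by
        by_cases hx : x = 0
        · rw [hx, norm_zero, Real.zero_rpow hα0.ne']; positivity
        · have := h2 ‖x‖ (1 + ‖gradient φ x‖ ^ 2 / D) (norm_pos_iff.2 hx) (by positivity)
            (growth_raw2 hV hW hφ hc hpush x hx)
          have h3 : ‖x‖ ≤ K2 * (1 + ‖gradient φ x‖) ^ (mD / md) := by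
            refine this.trans ?_
            gcongr
            calc (1 + ‖gradient φ x‖ ^ 2 / D) ^ (mD / (2 * md))
                ≤ ((1 + ‖gradient φ x‖) ^ 2) ^ (mD / (2 * md)) := by
                  gcongr; exact one_add_sq_le (norm_nonneg _) hD1
              _ = (1 + ‖gradient φ x‖) ^ (mD / md) := by
                  rw [← Real.rpow_natCast, ← Real.rpow_mul (by positivity)]; congr 1
                  push_cast; field_simp
          have h4 := Real.rpow_le_rpow (norm_nonneg x) h3 hα0.le
          rw [Real.mul_rpow hK2.le (by positivity), ← Real.rpow_mul (by positivity)] at h4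
          have e : mD / md * α = 1 := by rw [hα]; field_simp
          rwa [e, Real.rpow_one] at h4
      have : 0 ≤ ‖gradient φ x‖ := norm_nonneg _
      nlinarith
    have : 0 ≤ K1 * (1 + ‖gradient φ x‖) := by positivity
    linarith

/-- quantitative growth -/
lemma growth_quant {n : ℕ} {V W : Euc n → ℝ} {d D cv Cv cw Cw : ℝ} (hV : Comp n V d cv Cv)
    (hW : Comp n W D cw Cw) (hdD : d ≤ D) {φ : Euc n → ℝ} (hφ : ContDiff ℝ 2 φ)
    (hc : ConvexOn ℝ univ φ)
    (hpush : Measure.map (fun x => gradient φ x) (muUP V d) = muUP W D)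
    (q1 : 1 ≤ Cv / cv) (q2 : 1 ≤ Cw / cw) (x : Euc n) :
    1 + ‖gradient φ x‖ ^ 2 / D ≤ 10 ^ 6 * (Cv / cv) ^ 2 * (Cw / cw) ^ 2 * (1 + ‖x‖ ^ 2 / d) := by
  have hn1 : (1 : ℝ) ≤ n := by exact_mod_cast hV.hn
  have hd1 : 1 ≤ d := hn1.trans hV.hp
  have hD1 : 1 ≤ D := hd1.trans hdD
  have hnd := hV.hp
  have m1 : 0 < d - (n : ℝ) / 2 := by linarith
  have m2 : 0 < D - (n : ℝ) / 2 := by linarith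
  have h := growth_raw1 hV hW hφ hc hpush x
  set qv := Cv / cv
  set qw := Cw / cw
  set R := ‖gradient φ x‖ with hR
  have hS1 : 1 ≤ 1 + ‖x‖ ^ 2 / d := by
    have : 0 ≤ ‖x‖ ^ 2 / d := by positivity
    linarith
  set S := 1 + ‖x‖ ^ 2 / d
  have hq : 1 ≤ qv ^ 2 * qw ^ 2 := one_le_mul_of_one_le_of_one_le (one_le_pow₀ q1) (one_le_pow₀ q2)
  have hqS : 1 ≤ qv ^ 2 * qw ^ 2 * S := one_le_mul_of_one_le_of_one_le hq hS1
  by_cases hx : gradient φ x = 0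
  · have : R = 0 := by rw [hR, hx, norm_zero]
    rw [this]; norm_num; linarith
  have hRp : 0 < R := norm_pos_iff.2 hx
  have h := h hx
  set X := R ^ 2 / (9 * D) with hX
  have hXp : 0 < X := by positivity
  have e1 : D / (R / 3) ^ 2 = X⁻¹ := by rw [hX]; field_simp; ring
  rw [e1, Real.inv_rpow hXp.le] at h
  have key : X ≤ (80 * (qv * qw)) ^ 2 * S := by
    set m := D - (n : ℝ) / 2 with hm
    have a1 : 0 < X ^ m := by positivity
    have h2 : X ^ m ≤ qw ^ D * 2 ^ D * qv ^ d * 10 ^ d * 2 * 2 ^ n * S ^ (d - (n : ℝ) / 2) := by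
      rw [Real.rpow_neg (by positivity), Real.rpow_neg (by positivity), Real.rpow_neg (by positivity)] at h
      have a2 : 0 < S ^ (d - (n : ℝ) / 2) := by positivity
      have a3 : 0 < qv ^ d := by positivity
      have a4 : (0 : ℝ) < 10 ^ d := by positivity
      generalize S ^ (d - (n : ℝ) / 2) = s at *
      generalize qv ^ d = s1 at *
      generalize (10 : ℝ) ^ d = s2 at *
      generalize X ^ m = s3 at *
      have h3 := mul_le_mul_of_nonneg_left h (show 0 ≤ s1 * s2 * 2 * 2 ^ n * s * s3 by positivity)
      calc s3 = s1 * s2 * 2 * 2 ^ n * s * s3 * (s1⁻¹ * s2⁻¹ * (1 / 2) * (1 / 2) ^ n * s⁻¹) := by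
            rw [one_div, inv_pow]; field_simp
        _ ≤ _ := h3
        _ = _ := by field_simp
    have h3 : X ^ m ≤ (80 * (qv * qw)) ^ D * S ^ m := by
      refine h2.trans ?_
      have b1 : qv ^ d ≤ qv ^ D := Real.rpow_le_rpow_of_exponent_le q1 hdD
      have b2 : (10 : ℝ) ^ d ≤ 10 ^ D := Real.rpow_le_rpow_of_exponent_le (by norm_num) hdD
      have b3 : (2 : ℝ) ≤ 2 ^ D := by
        have := Real.rpow_le_rpow_of_exponent_le (show (1 : ℝ) ≤ 2 by norm_num) hD1
        rwa [Real.rpow_one] at this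
      have b4 : (2 : ℝ) ^ n ≤ 2 ^ D := by
        rw [← Real.rpow_natCast]
        exact Real.rpow_le_rpow_of_exponent_le (by norm_num) (hnd.trans hdD)
      have b5 : S ^ (d - (n : ℝ) / 2) ≤ S ^ m := Real.rpow_le_rpow_of_exponent_le hS1 (by linarith)
      calc _ ≤ qw ^ D * 2 ^ D * qv ^ D * 10 ^ D * 2 ^ D * 2 ^ D * S ^ m := by gcongr
        _ = _ := by
          have : 80 * (qv * qw) = qw * 2 * qv * 10 * 2 * 2 := by ring
          rw [this, Real.mul_rpow (by positivity) (by positivity),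
            Real.mul_rpow (by positivity) (by positivity),
            Real.mul_rpow (by positivity) (by positivity),
            Real.mul_rpow (by positivity) (by positivity),
            Real.mul_rpow (by positivity) (by positivity)]
    have h4 : (80 * (qv * qw)) ^ D ≤ ((80 * (qv * qw)) ^ 2) ^ m := by
      rw [← Real.rpow_natCast, ← Real.rpow_mul (by positivity)]
      apply Real.rpow_le_rpow_of_exponent_le
      · have : 1 ≤ qv * qw := one_le_mul_of_one_le_of_one_le q1 q2
        linarith
      · push_cast; rw [hm]; linarith
    have h5 : X ^ m ≤ ((80 * (qv * qw)) ^ 2 * S) ^ m := by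
      rw [Real.mul_rpow (by positivity) (by positivity)]
      exact h3.trans (by gcongr)
    exact (Real.rpow_le_rpow_iff hXp.le (by positivity) m2).1 h5
  have e2 : R ^ 2 / D = 9 * X := by rw [hX]; field_simp
  rw [e2]
  nlinarith

lemma rpow_large {α : ℝ} (hα : 0 < α) (k : ℝ) : ∃ R : ℝ, 1 ≤ R ∧ ∀ r, R ≤ r → k ≤ r ^ α := by
  have h := (tendsto_rpow_atTop hα).eventually (Filter.eventually_ge_atTop k)
  obtain ⟨R, hR⟩ := Filter.eventually_atTop.1 h
  exact ⟨max 1 R, le_max_left _ _, fun r hr => hR r ((le_max_right _ _).trans hr)⟩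

lemma T_surj {n : ℕ} {V W : Euc n → ℝ} {d D cv Cv cw Cw : ℝ} (_hV : Comp n V d cv Cv)
    (hW : Comp n W D cw Cw) {φ : Euc n → ℝ} (hφ : ContDiff ℝ 2 φ)
    (hpush : Measure.map (fun x => gradient φ x) (muUP V d) = muUP W D)
    (K α : ℝ) (hK : 0 < K) (hα : 0 < α)
    (h2 : ∀ x : Euc n, (1 + ‖x‖) ^ α ≤ K * (1 + ‖gradient φ x‖)) :
    Function.Surjective (fun x => gradient φ x) := by
  have hTc : Continuous (fun x => gradient φ x) := (grad_contDiff hφ).continuous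
  have hprop : IsProperMap (fun x => gradient φ x) := by
    rw [isProperMap_iff_tendsto_cocompact]
    refine ⟨hTc, ?_⟩
    rw [← Metric.cobounded_eq_cocompact, ← tendsto_norm_atTop_iff_cobounded]
    rw [Filter.tendsto_atTop]
    intro b
    obtain ⟨R, hR1, hR⟩ := rpow_large hα (K * (1 + b))
    have h3 : ∀ᶠ x in Bornology.cobounded (Euc n), R ≤ ‖x‖ :=
      tendsto_norm_cobounded_atTop.eventually (Filter.eventually_ge_atTop R)
    filter_upwards [h3] with x hx
    have h4 := (hR (1 + ‖x‖) (by linarith)).trans (h2 x)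
    have := le_of_mul_le_mul_left h4 hK
    linarith
  have hcl : IsClosed (range (fun x => gradient φ x)) := hprop.isClosedMap.isClosed_range
  have hopen : IsOpen (range (fun x => gradient φ x))ᶜ := hcl.isOpen_compl
  have h0 : muUP W D (range (fun x => gradient φ x))ᶜ = 0 := by
    rw [← hpush, Measure.map_apply hTc.measurable hopen.measurableSet]
    have : (fun x => gradient φ x) ⁻¹' (range (fun x => gradient φ x))ᶜ = ∅ := by
      ext x; simp
    rw [this, measure_empty]
  have hac : (volume : Measure (Euc n)) ≪ muUP W D := by
    apply withDensity_absolutelyContinuous'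
    · have : Measurable fun x => (Znorm W D)⁻¹ * (1 + W x / D) ^ (-D) := by
        have := hW.hU.measurable
        fun_prop
      exact this.ennreal_ofReal.aemeasurable
    · refine Filter.Eventually.of_forall fun x => ?_
      have h1 := hW.Z_pos
      have h2 := hW.pos x
      have : 0 < (Znorm W D)⁻¹ * (1 + W x / D) ^ (-D) := by positivity
      exact (ENNReal.ofReal_pos.2 this).ne'
  have h1 := hac h0
  have h1 := (hopen.measure_eq_zero_iff (volume : Measure (Euc n))).1 h1
  exact range_eq_univ.1 (compl_empty_iff.1 h1)

lemma phi_growth {n : ℕ} {φ : Euc n → ℝ} (hφ : ContDiff ℝ 2 φ) (hc : ConvexOn ℝ univ φ)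
    (hs : Function.Surjective (fun x => gradient φ x))
    (K α : ℝ) (hK : 0 < K) (hα : 0 < α) (hα1 : α ≤ 1)
    (h1 : ∀ x : Euc n, ‖gradient φ x‖ ≤ K * (1 + ‖x‖) ^ α)
    (h2 : ∀ x : Euc n, (1 + ‖x‖) ^ α ≤ K * (1 + ‖gradient φ x‖)) :
    ∃ (w0 : Euc n) (N : ℝ), 0 < N ∧ (∀ x, φ w0 ≤ φ x) ∧
      (∀ x, ‖gradient φ x‖ ^ 2 ≤ N * (1 + (φ x - φ w0))) ∧
      (∀ ε : ℝ, 0 < ε → ∃ R : ℝ, ∀ x : Euc n, R ≤ ‖x‖ → 1 + ‖x‖ ≤ ε * (1 + (φ x - φ w0))) := by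
  obtain ⟨w0, hw0⟩ := hs 0
  have hw0' : gradient φ w0 = 0 := hw0
  have hmin : ∀ x, φ w0 ≤ φ x := fun x => by
    have := conv_grad hφ hc w0 x
    rwa [hw0', inner_zero_left, add_zero] at this
  obtain ⟨R0, hR01, hR0⟩ := rpow_large hα (2 * K * 2 ^ α)
  have h2α : (0 : ℝ) < 2 ^ α := by positivity
  set c := (1 / 2) * (2 ^ α)⁻¹ / K with hcdef
  have hc0 : 0 < c := by positivity
  have main : ∀ x : Euc n, R0 ≤ ‖x‖ → c / 2 * (‖x‖ ^ α * ‖x‖) ≤ φ x - φ w0 := by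
    intro x hx
    have hr0 : 0 < ‖x‖ := by linarith
    obtain ⟨w, hw⟩ := hs ((c * ‖x‖ ^ α) • (‖x‖⁻¹ • x))
    have hw' : gradient φ w = (c * ‖x‖ ^ α) • (‖x‖⁻¹ • x) := hw
    have hu : ‖‖x‖⁻¹ • x‖ = 1 := by rw [norm_smul, norm_inv, norm_norm, inv_mul_cancel₀ hr0.ne']
    have hk0 : 0 ≤ c * ‖x‖ ^ α := by positivity
    have hnw : ‖gradient φ w‖ = c * ‖x‖ ^ α := by
      rw [hw', norm_smul, hu, Real.norm_of_nonneg hk0, mul_one]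
    have h3 : (1 + ‖w‖) ^ α ≤ (‖x‖ / 2) ^ α := by
      refine (h2 w).trans ?_
      rw [hnw, Real.div_rpow hr0.le (by norm_num), le_div_iff₀ h2α]
      have := hR0 _ hx
      have e : K * (1 + c * ‖x‖ ^ α) * 2 ^ α = K * 2 ^ α + (1 / 2) * ‖x‖ ^ α := by
        rw [hcdef]; field_simp
      rw [e]; linarith
    have h4 : 1 + ‖w‖ ≤ ‖x‖ / 2 := (Real.rpow_le_rpow_iff (by positivity) (by positivity) hα).1 h3
    have h5 := conv_grad hφ hc w x
    rw [hw', inner_sub_right, inner_smul_left, inner_smul_left, real_inner_self_eq_norm_sq] at h5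
    have h6 : ⟪(c * ‖x‖ ^ α) • (‖x‖⁻¹ • x), w⟫ ≤ c * ‖x‖ ^ α * ‖w‖ := by
      refine (real_inner_le_norm _ _).trans ?_
      rw [norm_smul, hu, Real.norm_of_nonneg hk0, mul_one]
    simp only [conj_trivial] at h5
    have e : c * ‖x‖ ^ α * (‖x‖⁻¹ * ‖x‖ ^ 2) = c * ‖x‖ ^ α * ‖x‖ := by field_simp
    rw [e] at h5
    have h7 : c * ‖x‖ ^ α * ‖w‖ ≤ c * ‖x‖ ^ α * (‖x‖ / 2) := by gcongr; linarith
    have := hmin w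
    linarith
  refine ⟨w0, K ^ 2 * (1 + R0) ^ 2 + K ^ 2 * 4 * (2 / c), by positivity, hmin, ?_, ?_⟩
  · intro x
    have hψ : 0 ≤ φ x - φ w0 := sub_nonneg.2 (hmin x)
    have hx0 := norm_nonneg x
    have hb : ‖gradient φ x‖ ^ 2 ≤ K ^ 2 * ((1 + ‖x‖) ^ α) ^ 2 := by
      rw [← mul_pow]; have := h1 x; gcongr
    by_cases hx : R0 ≤ ‖x‖
    · have e1 : (1 + ‖x‖) ^ α ≤ (2 * ‖x‖) ^ α := by gcongr; linarith
      have e2 : (2 * ‖x‖) ^ α ≤ 2 * ‖x‖ ^ α := by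
        rw [Real.mul_rpow (by norm_num) hx0]
        gcongr
        calc (2 : ℝ) ^ α ≤ 2 ^ (1 : ℝ) := Real.rpow_le_rpow_of_exponent_le (by norm_num) hα1
          _ = 2 := Real.rpow_one _
      have e3 : ‖x‖ ^ α ≤ ‖x‖ := by
        calc ‖x‖ ^ α ≤ ‖x‖ ^ (1 : ℝ) := Real.rpow_le_rpow_of_exponent_le (by linarith) hα1
          _ = _ := Real.rpow_one _
      have e4 : ((1 + ‖x‖) ^ α) ^ 2 ≤ 4 * (‖x‖ ^ α * ‖x‖) := by
        have : (1 + ‖x‖) ^ α ≤ 2 * ‖x‖ ^ α := e1.trans e2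
        calc ((1 + ‖x‖) ^ α) ^ 2 ≤ (2 * ‖x‖ ^ α) ^ 2 := by gcongr
          _ = 4 * (‖x‖ ^ α * ‖x‖ ^ α) := by ring
          _ ≤ _ := by gcongr
      have e5 : ‖x‖ ^ α * ‖x‖ ≤ (2 / c) * (φ x - φ w0) := by
        have := main x hx
        calc ‖x‖ ^ α * ‖x‖ = (2 / c) * (c / 2 * (‖x‖ ^ α * ‖x‖)) := by field_simp
          _ ≤ _ := by gcongr
      calc _ ≤ K ^ 2 * ((1 + ‖x‖) ^ α) ^ 2 := hb
        _ ≤ K ^ 2 * (4 * ((2 / c) * (φ x - φ w0))) := by gcongr; exact e4.trans (by gcongr)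
        _ ≤ _ := by
          have : 0 ≤ K ^ 2 * (1 + R0) ^ 2 * (1 + (φ x - φ w0)) := by positivity
          have : 0 ≤ K ^ 2 * 4 * (2 / c) := by positivity
          nlinarith
    · have hx' := (not_le.1 hx).le
      have e1 : (1 + ‖x‖) ^ α ≤ 1 + R0 := by
        calc (1 + ‖x‖) ^ α ≤ (1 + ‖x‖) ^ (1 : ℝ) :=
              Real.rpow_le_rpow_of_exponent_le (by linarith) hα1
          _ = 1 + ‖x‖ := Real.rpow_one _
          _ ≤ _ := by linarith
      calc _ ≤ K ^ 2 * ((1 + ‖x‖) ^ α) ^ 2 := hb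
        _ ≤ K ^ 2 * (1 + R0) ^ 2 := by gcongr
        _ ≤ _ := by
          have : 0 ≤ K ^ 2 * (1 + R0) ^ 2 := by positivity
          have : 0 ≤ K ^ 2 * 4 * (2 / c) * (1 + (φ x - φ w0)) := by positivity
          nlinarith
  · intro ε hε
    obtain ⟨R1, hR11, hR1⟩ := rpow_large hα (4 / (c * ε))
    refine ⟨max R0 R1, fun x hx => ?_⟩
    have hx0 : R0 ≤ ‖x‖ := (le_max_left _ _).trans hx
    have hx1 : R1 ≤ ‖x‖ := (le_max_right _ _).trans hx
    have h3 := main x hx0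
    have h4 := hR1 _ hx1
    have hr0 : 0 ≤ ‖x‖ := norm_nonneg x
    have h5 : 2 * ‖x‖ ≤ ε * (c / 2 * (‖x‖ ^ α * ‖x‖)) := by
      calc 2 * ‖x‖ = ε * (c / 2 * (4 / (c * ε) * ‖x‖)) := by field_simp; ring
        _ ≤ _ := by gcongr
    have h6 : ε * (c / 2 * (‖x‖ ^ α * ‖x‖)) ≤ ε * (φ x - φ w0) := by gcongr
    linarith

lemma ma_root {n : ℕ} {V W : Euc n → ℝ} {d D cv Cv cw Cw : ℝ} (hV : Comp n V d cv Cv)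
    (hW : Comp n W D cw Cw) {φ : Euc n → ℝ} (hφ : ContDiff ℝ 2 φ) (hc : ConvexOn ℝ univ φ)
    (hpush : Measure.map (fun x => gradient φ x) (muUP V d) = muUP W D) :
    ∃ K : ℝ, 0 < K ∧ ∀ x, 0 < (fderiv ℝ (gradient φ) x).det ∧
      1 + W (gradient φ x) / D = K * (1 + V x / d) ^ (d / D) *
        (fderiv ℝ (gradient φ) x).det ^ (1 / D) := by
  have hd := hV.p_pos
  have hD := hW.p_pos
  have hZV := hV.Z_pos
  have hZW := hW.Z_pos
  have cV : Continuous fun x => (Znorm V d)⁻¹ * (1 + V x / d) ^ (-d) := by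
    refine continuous_const.mul (Continuous.rpow_const ?_ fun x => Or.inl (hV.pos x).ne')
    have := hV.hU
    fun_prop
  have cW : Continuous fun x => (Znorm W D)⁻¹ * (1 + W x / D) ^ (-D) := by
    refine continuous_const.mul (Continuous.rpow_const ?_ fun x => Or.inl (hW.pos x).ne')
    have := hW.hU
    fun_prop
  have pV : ∀ x, 0 < (Znorm V d)⁻¹ * (1 + V x / d) ^ (-d) := fun x => by
    have := hV.pos x; positivity
  have pW : ∀ x, 0 < (Znorm W D)⁻¹ * (1 + W x / D) ^ (-D) := fun x => by
    have := hW.pos x; positivity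
  have key := monge_ampere hφ hc _ _ cV cW pV pW hpush
  refine ⟨(Znorm V d / Znorm W D) ^ (1 / D), by positivity, fun x => ?_⟩
  have hk := key x
  have hpV := hV.pos x
  have hpW := hW.pos (gradient φ x)
  have hdet : 0 < (fderiv ℝ (gradient φ) x).det := by
    have h1 := pV x
    rw [hk] at h1
    exact pos_of_mul_pos_right h1 (pW _).le
  refine ⟨hdet, ?_⟩
  generalize (fderiv ℝ (gradient φ) x).det = δ at *
  generalize 1 + W (gradient φ x) / D = F at *
  generalize 1 + V x / d = u at *
  rw [Real.rpow_neg hpV.le, Real.rpow_neg hpW.le] at hk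
  have a1 : 0 < u ^ d := by positivity
  have a2 : 0 < F ^ D := by positivity
  have h1 : F ^ D = (Znorm V d / Znorm W D) * u ^ d * δ := by
    field_simp at hk
    field_simp
    linarith
  have h2 : (F ^ D) ^ (1 / D) = F := by
    rw [← Real.rpow_mul hpW.le, mul_one_div_cancel hD.ne', Real.rpow_one]
  rw [← h2, h1, Real.mul_rpow (by positivity) hdet.le, Real.mul_rpow (by positivity) a1.le,
    ← Real.rpow_mul hpV.le, mul_one_div]

lemma frac_alg (F G Fp Fm Gp Gm a b c g τ : ℝ) (hF : 0 < F) (hG : 0 < G) (hGp : 0 < Gp)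
    (hGm : 0 < Gm) (hFp0 : 0 < Fp) (hFm0 : 0 < Fm) (hc : 0 ≤ c) (hτ : 1 ≤ τ)
    (hFp : F + b + a ≤ Fp) (hFm : F + b - a ≤ Fm)
    (h1 : Gp ≤ G + c + g) (h2 : Gm ≤ G + c - g) (h : Fp / Gp + Fm / Gm ≤ 2 * τ * (F / G)) :
    b ≤ τ * F * (c / G) + |a| * (|g| / G) + (τ - 1) * F := by
  have p1 : 0 < G + c + g := by linarith
  have p2 : 0 < G + c - g := by linarith
  have q1 : (F + b + a) / (G + c + g) ≤ Fp / Gp :=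
    (div_le_div_of_nonneg_right hFp p1.le).trans (div_le_div_of_nonneg_left hFp0.le hGp h1)
  have q2 : (F + b - a) / (G + c - g) ≤ Fm / Gm :=
    (div_le_div_of_nonneg_right hFm p2.le).trans (div_le_div_of_nonneg_left hFm0.le hGm h2)
  have q3 : (F + b + a) / (G + c + g) + (F + b - a) / (G + c - g) ≤ 2 * τ * (F / G) := by linarith
  rw [div_add_div _ _ p1.ne' p2.ne', div_le_iff₀ (mul_pos p1 p2)] at q3
  have hk : 0 ≤ τ * (F / G) := by positivity
  have q4 : (F + b) * (G + c) ≤ |a| * |g| + τ * (F / G) * (G + c) ^ 2 := by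
    have : a * g ≤ |a| * |g| := by rw [← abs_mul]; exact le_abs_self _
    nlinarith [mul_nonneg hk (sq_nonneg g)]
  have hGc : 0 < G + c := by linarith
  have q5 : F + b ≤ |a| * |g| / (G + c) + τ * (F / G) * (G + c) := by
    rw [div_add' _ _ _ hGc.ne', le_div_iff₀ hGc]
    linarith
  have q6 : |a| * |g| / (G + c) ≤ |a| * |g| / G :=
    div_le_div_of_nonneg_left (by positivity) hG (by linarith)
  have e : τ * (F / G) * (G + c) = τ * F * (c / G) + τ * F := by field_simp; ring
  rw [e] at q5
  have e7 : |a| * |g| / G = |a| * (|g| / G) := mul_div_assoc _ _ _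
  rw [e7] at q6
  linarith

/-- all the standing facts -/
structure Ctx (n : ℕ) (V W φ : Euc n → ℝ) (d D cW2 CV2 cV CW sV sW M N : ℝ) : Prop where
  hn : 1 ≤ n
  hnd : (n : ℝ) ≤ d
  hdD : d ≤ D
  hV : ContDiff ℝ 2 V
  hW : ContDiff ℝ 2 W
  hφ : ContDiff ℝ 2 φ
  hc : ConvexOn ℝ univ φ
  hCV2 : 0 < CV2
  hcW2 : 0 < cW2
  hHV : ∀ x v : Euc n, hess V x v ≤ CV2 * ‖v‖ ^ 2
  hHW : ∀ x v : Euc n, cW2 * ‖v‖ ^ 2 ≤ hess W x v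
  hcV : 0 < cV
  hCW : 0 < CW
  lowV : ∀ x, cV * (d + ‖x‖ ^ 2) ≤ d + V x
  upW : ∀ y, D + W y ≤ CW * (D + ‖y‖ ^ 2)
  posW : ∀ y, 0 < D + W y
  hsV : 0 ≤ sV
  hsW : 0 ≤ sW
  gV : ∀ x, ‖gradient V x‖ ≤ sV * (Real.sqrt n + ‖x‖)
  gW : ∀ x, ‖gradient W x‖ ≤ sW * (Real.sqrt n + ‖x‖)
  hM : 0 < M
  grow : ∀ x, 1 + ‖gradient φ x‖ ^ 2 / D ≤ M * (1 + ‖x‖ ^ 2 / d)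
  hN : 0 < N
  hφ0 : ∀ x, 0 ≤ φ x
  hφN : ∀ x, ‖gradient φ x‖ ^ 2 ≤ N * (1 + φ x)
  hMA : ∃ K : ℝ, 0 < K ∧ ∀ x, 0 < (fderiv ℝ (gradient φ) x).det ∧
      1 + W (gradient φ x) / D = K * (1 + V x / d) ^ (d / D) *
        (fderiv ℝ (gradient φ) x).det ^ (1 / D)

namespace Ctx
variable {n : ℕ} {V W φ : Euc n → ℝ} {d D cW2 CV2 cV CW sV sW M N : ℝ}

lemma n1 (h : Ctx n V W φ d D cW2 CV2 cV CW sV sW M N) : (1 : ℝ) ≤ n := by exact_mod_cast h.hn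

lemma d_pos (h : Ctx n V W φ d D cW2 CV2 cV CW sV sW M N) : 0 < d := by
  linarith [h.n1, h.hnd]

lemma D_pos (h : Ctx n V W φ d D cW2 CV2 cV CW sV sW M N) : 0 < D := by
  linarith [h.d_pos, h.hdD]

lemma posV (h : Ctx n V W φ d D cW2 CV2 cV CW sV sW M N) (x : Euc n) : 0 < d + V x := by
  have := h.d_pos
  have := h.hcV
  exact lt_of_lt_of_le (by positivity) (h.lowV x)

/-- concavity of the determinant along the critical configuration -/
lemma frac_le (h : Ctx n V W φ d D cW2 CV2 cV CW sV sW M N) (x z : Euc n) (τ : ℝ) (hτ : 1 ≤ τ)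
    (hh : ∀ v, hess φ (x + z) v + hess φ (x - z) v ≤ 2 * τ * hess φ x v) :
    (1 + W (gradient φ (x + z)) / D) / (1 + V (x + z) / d) ^ (d / D) +
    (1 + W (gradient φ (x - z)) / D) / (1 + V (x - z) / d) ^ (d / D) ≤
    2 * τ * ((1 + W (gradient φ x) / D) / (1 + V x / d) ^ (d / D)) := by
  obtain ⟨K, hK, hMA⟩ := h.hMA
  have hd := h.d_pos
  have hq : ∀ y, (1 + W (gradient φ y) / D) / (1 + V y / d) ^ (d / D)
      = K * (fderiv ℝ (gradient φ) y).det ^ (1 / D) := by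
    intro y
    have hp : 0 < 1 + V y / d := by
      have := h.posV y
      have e : 1 + V y / d = (d + V y) / d := by field_simp
      rw [e]; positivity
    have : 0 < (1 + V y / d) ^ (d / D) := by positivity
    rw [(hMA y).2, div_eq_iff this.ne']; ring
  rw [hq, hq, hq]
  have hsym : ∀ y v w, ⟪fderiv ℝ (gradient φ) y v, w⟫ = ⟪v, fderiv ℝ (gradient φ) y w⟫ := by
    intro y v w
    exact hess_symm h.hφ y v w
  have hpsd : ∀ y v, 0 ≤ ⟪fderiv ℝ (gradient φ) y v, v⟫ := by
    intro y v
    rw [← hess_eq h.hφ]; exact conv_hess h.hφ h.hc y v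
  have := det_concave _ _ _ (hsym x) (hsym (x + z)) (hsym (x - z)) (hpsd x) (hpsd (x + z))
    (hpsd (x - z)) (hMA x).1.ne' τ D hτ h.D_pos (h.hnd.trans h.hdD) (by
      intro v
      have := hh v
      rwa [hess_eq h.hφ, hess_eq h.hφ, hess_eq h.hφ] at this)
  nlinarith

lemma G_up (h : Ctx n V W φ d D cW2 CV2 cV CW sV sW M N) (x z : Euc n) :
    (1 + V (x + z) / d) ^ (d / D) ≤ (1 + V x / d) ^ (d / D) +
      (1 + V x / d) ^ (d / D) * (d / D) * (CV2 * ‖z‖ ^ 2 / 2) / (d + V x) +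
      (1 + V x / d) ^ (d / D) * (d / D) * ⟪gradient V x, z⟫ / (d + V x) := by
  have hd := h.d_pos
  have hD := h.D_pos
  have h1 := quad_upper h.hV h.hHV x z
  have p1 := h.posV x
  have p2 := h.posV (x + z)
  have e1 : 1 + V (x + z) / d = (1 + V x / d) * (1 + (V (x + z) - V x) / (d + V x)) := by
    field_simp; ring
  have e2 : 0 < 1 + V x / d := by
    have e : 1 + V x / d = (d + V x) / d := by field_simp
    rw [e]; positivity
  have e3 : 1 + (V (x + z) - V x) / (d + V x) = (d + V (x + z)) / (d + V x) := by field_simp; ring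
  have e4 : -1 ≤ (V (x + z) - V x) / (d + V x) := by
    have : 0 < (d + V (x + z)) / (d + V x) := by positivity
    linarith
  have h2 := rpow_one_add_le_one_add_mul_self e4 (p := d / D) (by positivity)
    ((div_le_one hD).2 h.hdD)
  have h3 : (V (x + z) - V x) / (d + V x) ≤ (⟪gradient V x, z⟫ + CV2 * ‖z‖ ^ 2 / 2) / (d + V x) := by
    gcongr; linarith
  have hθ : 0 < d / D := by positivity
  rw [e1, Real.mul_rpow e2.le (by rw [e3]; positivity)]
  have h4 : 0 < (1 + V x / d) ^ (d / D) := by positivity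
  calc (1 + V x / d) ^ (d / D) * (1 + (V (x + z) - V x) / (d + V x)) ^ (d / D)
      ≤ (1 + V x / d) ^ (d / D) *
        (1 + d / D * ((⟪gradient V x, z⟫ + CV2 * ‖z‖ ^ 2 / 2) / (d + V x))) := by
        gcongr
        exact h2.trans (by gcongr)
    _ = _ := by ring

end Ctx

namespace Ctx
variable {n : ℕ} {V W φ : Euc n → ℝ} {d D cW2 CV2 cV CW sV sW M N : ℝ}

lemma W_low (h : Ctx n V W φ d D cW2 CV2 cV CW sV sW M N) (T v : Euc n) (η : ℝ) (hη : 0 ≤ η) :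
    W T - η * (sW * (Real.sqrt n + ‖T‖) * ‖T‖) + ⟪gradient W ((1 + η) • T), v⟫ + cW2 * ‖v‖ ^ 2 / 2 ≤
      W ((1 + η) • T + v) := by
  have h1 := quad_lower h.hW h.hHW ((1 + η) • T) v
  have h2 := quad_lower h.hW h.hHW T (η • T)
  have e : T + η • T = (1 + η) • T := by rw [add_smul, one_smul]
  rw [e, inner_smul_right] at h2
  have h3 : -(‖gradient W T‖ * ‖T‖) ≤ ⟪gradient W T, T⟫ := by
    have := abs_real_inner_le_norm (gradient W T) T
    linarith [neg_abs_le ⟪gradient W T, T⟫]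
  have h4 : ‖gradient W T‖ * ‖T‖ ≤ sW * (Real.sqrt n + ‖T‖) * ‖T‖ := by
    have := h.gW T; gcongr
  have h5 : 0 ≤ cW2 * ‖η • T‖ ^ 2 / 2 := by have := h.hcW2; positivity
  have h6 : η * (-(sW * (Real.sqrt n + ‖T‖) * ‖T‖)) ≤ η * ⟪gradient W T, T⟫ := by
    gcongr; linarith
  linarith

lemma crit1 (h : Ctx n V W φ d D cW2 CV2 cV CW sV sW M N) (x z : Euc n) (η Y : ℝ) (hη : 0 ≤ η)
    (hY : 0 < Y) (hz : z ≠ 0)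
    (hp : gradient φ (x + z) = (1 + η) • gradient φ x + Y • z)
    (hm : gradient φ (x - z) = (1 + η) • gradient φ x - Y • z)
    (hh : ∀ v, hess φ (x + z) v + hess φ (x - z) v ≤ 2 * (1 + η) * hess φ x v) :
    cW2 * Y ^ 2 ≤ (1 + η) * CV2 * ((d / D) * (D + W (gradient φ x)) / (d + V x))
      + 2 * Y * ‖gradient W ((1 + η) • gradient φ x)‖ * ‖gradient V x‖ * ((d / D) / (d + V x))
      + 2 * η * (sW * (Real.sqrt n + ‖gradient φ x‖) * ‖gradient φ x‖ + (D + W (gradient φ x)))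
        / ‖z‖ ^ 2 := by
  have hd := h.d_pos
  have hD := h.D_pos
  have hs : 0 < ‖z‖ := norm_pos_iff.2 hz
  have hfr := h.frac_le x z (1 + η) (by linarith) hh
  have g1 := h.G_up x z
  have g2 := h.G_up x (-z)
  rw [← sub_eq_add_neg, norm_neg, inner_neg_right] at g2
  have w1 := h.W_low (gradient φ x) (Y • z) η hη
  have w2 := h.W_low (gradient φ x) (-(Y • z)) η hη
  rw [← sub_eq_add_neg, norm_neg, inner_neg_right, ← hm] at w2
  rw [← hp] at w1
  rw [inner_smul_right, norm_smul, Real.norm_of_nonneg hY.le] at w1 w2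
  have pV : ∀ y, 0 < 1 + V y / d := fun y => by
    have := h.posV y
    have e : 1 + V y / d = (d + V y) / d := by field_simp
    rw [e]; positivity
  have pW : ∀ y, 0 < 1 + W y / D := fun y => by
    have := h.posW y
    have e : 1 + W y / D = (D + W y) / D := by field_simp
    rw [e]; positivity
  have pV0 := h.posV x
  have pG : ∀ y, 0 < (1 + V y / d) ^ (d / D) := fun y => Real.rpow_pos_of_pos (pV y) _
  set T := gradient φ x with hT
  set e1 := sW * (Real.sqrt n + ‖T‖) * ‖T‖ with he1
  set G := (1 + V x / d) ^ (d / D) with hG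
  have hCV := h.hCV2
  have key := frac_alg (1 + W T / D) G _ _ _ _
    (Y * ⟪gradient W ((1 + η) • T), z⟫ / D) ((cW2 * (Y * ‖z‖) ^ 2 / 2 - η * e1) / D)
    (G * (d / D) * (CV2 * ‖z‖ ^ 2 / 2) / (d + V x))
    (G * (d / D) * ⟪gradient V x, z⟫ / (d + V x)) (1 + η) (pW _) (pG x) (pG (x + z)) (pG (x - z))
    (pW _) (pW _) (by have := pG x; positivity) (by linarith) ?_ ?_ g1 ?_ hfr
  · have c1 : |Y * ⟪gradient W ((1 + η) • T), z⟫ / D| ≤ Y * (‖gradient W ((1 + η) • T)‖ * ‖z‖) / D := by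
      rw [abs_div, abs_mul, abs_of_pos hY, abs_of_pos hD]
      have := abs_real_inner_le_norm (gradient W ((1 + η) • T)) z
      gcongr
    have c2 : |G * (d / D) * ⟪gradient V x, z⟫ / (d + V x)| / G
        ≤ (d / D) * (‖gradient V x‖ * ‖z‖) / (d + V x) := by
      have hGp := pG x
      rw [← hG] at hGp
      have hθ : 0 < d / D := by positivity
      rw [abs_div, abs_mul, abs_mul, abs_of_pos hGp, abs_of_pos hθ, abs_of_pos pV0]
      have := abs_real_inner_le_norm (gradient V x) z
      calc _ = (d / D) * |⟪gradient V x, z⟫| / (d + V x) := by field_simp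
        _ ≤ _ := by gcongr
    have c3 : G * (d / D) * (CV2 * ‖z‖ ^ 2 / 2) / (d + V x) / G =
        (d / D) * (CV2 * ‖z‖ ^ 2 / 2) / (d + V x) := by
      have hGp := pG x
      rw [← hG] at hGp
      field_simp
    rw [c3] at key
    have c4 := mul_le_mul c1 c2 (by have := pG x; positivity) (by positivity)
    have key2 := key.trans (add_le_add (add_le_add le_rfl c4) le_rfl)
    have e2 : 1 + W T / D = (D + W T) / D := by field_simp
    rw [e2] at key2
    have key3 := mul_le_mul_of_nonneg_left key2 (show 0 ≤ 2 * D / ‖z‖ ^ 2 by positivity)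
    have r1 : 2 * D / ‖z‖ ^ 2 * ((cW2 * (Y * ‖z‖) ^ 2 / 2 - η * e1) / D)
        = cW2 * Y ^ 2 - 2 * η * e1 / ‖z‖ ^ 2 := by field_simp
    rw [r1] at key3
    have r2 : 2 * D / ‖z‖ ^ 2 * ((1 + η) * ((D + W T) / D) * (d / D * (CV2 * ‖z‖ ^ 2 / 2) / (d + V x)) +
        Y * (‖gradient W ((1 + η) • T)‖ * ‖z‖) / D * (d / D * (‖gradient V x‖ * ‖z‖) / (d + V x)) +
        (1 + η - 1) * ((D + W T) / D)) = (1 + η) * CV2 * ((d / D) * (D + W T) / (d + V x))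
      + 2 * Y * ‖gradient W ((1 + η) • T)‖ * ‖gradient V x‖ * ((d / D) / (d + V x))
      + 2 * η * (D + W T) / ‖z‖ ^ 2 := by
      field_simp
      ring
    rw [r2] at key3
    have r3 : 2 * η * (e1 + (D + W T)) / ‖z‖ ^ 2 = 2 * η * e1 / ‖z‖ ^ 2 + 2 * η * (D + W T) / ‖z‖ ^ 2 := by
      ring
    rw [r3]; linarith
  · have e : 1 + W T / D + (cW2 * (Y * ‖z‖) ^ 2 / 2 - η * e1) / D +
        Y * ⟪gradient W ((1 + η) • T), z⟫ / D = 1 + (W T - η * e1 +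
        Y * ⟪gradient W ((1 + η) • T), z⟫ + cW2 * (Y * ‖z‖) ^ 2 / 2) / D := by ring
    rw [e]; gcongr
  · have e : 1 + W T / D + (cW2 * (Y * ‖z‖) ^ 2 / 2 - η * e1) / D -
        Y * ⟪gradient W ((1 + η) • T), z⟫ / D = 1 + (W T - η * e1 +
        -(Y * ⟪gradient W ((1 + η) • T), z⟫) + cW2 * (Y * ‖z‖) ^ 2 / 2) / D := by ring
    rw [e]; gcongr
  · refine g2.trans (le_of_eq ?_)
    ring

set_option maxHeartbeats 1000000 in
/-- the constant in the error term -/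
lemma crit2 (h : Ctx n V W φ d D cW2 CV2 cV CW sV sW M N) (x z : Euc n) (η Y β : ℝ) (hη : 0 ≤ η)
    (hY : 0 < Y) (hz : z ≠ 0) (hβ : η ≤ β * ‖z‖ ^ 2 * Y / (1 + φ x))
    (hp : gradient φ (x + z) = (1 + η) • gradient φ x + Y • z)
    (hm : gradient φ (x - z) = (1 + η) • gradient φ x - Y • z)
    (hh : ∀ v, hess φ (x + z) v + hess φ (x - z) v ≤ 2 * (1 + η) * hess φ x v) :
    cW2 * Y ^ 2 ≤ (1 + η) * (CV2 * CW * M / cV + 4 * Y * (sV * sW * Real.sqrt M / cV))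
      + 2 * β * Y * (sW * (n + 2 * N) + CW * (D + N)) := by
  have hd := h.d_pos
  have hD := h.D_pos
  have hs : 0 < ‖z‖ := norm_pos_iff.2 hz
  have h1 := h.crit1 x z η Y hη hY hz hp hm hh
  have hCV := h.hCV2
  have hcV := h.hcV
  have hCW := h.hCW
  have hsV := h.hsV
  have hsW := h.hsW
  have hM := h.hM
  have hN := h.hN
  have hφ0 := h.hφ0 x
  have pV := h.posV x
  have pW := h.posW (gradient φ x)
  have lV := h.lowV x
  have uW := h.upW (gradient φ x)
  have gr := h.grow x
  have hNT := h.hφN x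
  set T := gradient φ x with hT
  have hn0 : 0 ≤ Real.sqrt n := Real.sqrt_nonneg _
  have hnsq : Real.sqrt n ^ 2 = n := Real.sq_sqrt (Nat.cast_nonneg n)
  have hnd := h.hnd
  have hdD := h.hdD
  have hT0 : 0 ≤ ‖T‖ := norm_nonneg _
  have hx0 : 0 ≤ ‖x‖ := norm_nonneg _
  -- ratio bound
  have r0 : (d / D) * (D + ‖T‖ ^ 2) / (d + ‖x‖ ^ 2) ≤ M := by
    have e1 : (d / D) * (D + ‖T‖ ^ 2) = d * (1 + ‖T‖ ^ 2 / D) := by field_simp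
    rw [div_le_iff₀ (by positivity), e1]
    calc d * (1 + ‖T‖ ^ 2 / D) ≤ d * (M * (1 + ‖x‖ ^ 2 / d)) := by gcongr
      _ = _ := by field_simp
  have t1 : (1 + η) * CV2 * ((d / D) * (D + W T) / (d + V x)) ≤ (1 + η) * (CV2 * CW * M / cV) := by
    have : (d / D) * (D + W T) / (d + V x) ≤ CW * M / cV := by
      calc (d / D) * (D + W T) / (d + V x)
          ≤ (d / D) * (CW * (D + ‖T‖ ^ 2)) / (cV * (d + ‖x‖ ^ 2)) := by gcongr
        _ = CW / cV * ((d / D) * (D + ‖T‖ ^ 2) / (d + ‖x‖ ^ 2)) := by field_simp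
        _ ≤ CW / cV * M := by gcongr
        _ = _ := by ring
    calc _ ≤ (1 + η) * CV2 * (CW * M / cV) := by gcongr
      _ = _ := by ring
  have t2 : 2 * Y * ‖gradient W ((1 + η) • T)‖ * ‖gradient V x‖ * ((d / D) / (d + V x))
      ≤ (1 + η) * (4 * Y * (sV * sW * Real.sqrt M / cV)) := by
    have b1 : ‖gradient W ((1 + η) • T)‖ ≤ (1 + η) * (sW * (Real.sqrt n + ‖T‖)) := by
      refine (h.gW _).trans ?_
      rw [norm_smul, Real.norm_of_nonneg (by linarith)]
      have : Real.sqrt n + (1 + η) * ‖T‖ ≤ (1 + η) * (Real.sqrt n + ‖T‖) := by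
        nlinarith [mul_nonneg hη hn0]
      calc _ ≤ sW * ((1 + η) * (Real.sqrt n + ‖T‖)) := by gcongr
        _ = _ := by ring
    have b2 := h.gV x
    have b3 : (d / D) / (d + V x) ≤ (d / D) / (cV * (d + ‖x‖ ^ 2)) := by gcongr
    have b4 : (Real.sqrt n + ‖T‖) * (Real.sqrt n + ‖x‖) * ((d / D) / (d + ‖x‖ ^ 2)) ≤
        2 * Real.sqrt M := by
      refine (pow_le_pow_iff_left₀ (by positivity) (by positivity) two_ne_zero).1 ?_
      · rw [mul_pow, mul_pow, mul_pow, Real.sq_sqrt hM.le]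
        have c1 : (Real.sqrt n + ‖T‖) ^ 2 ≤ 2 * (D + ‖T‖ ^ 2) := by
          nlinarith [sq_nonneg (Real.sqrt n - ‖T‖)]
        have c2 : (Real.sqrt n + ‖x‖) ^ 2 ≤ 2 * (d + ‖x‖ ^ 2) := by
          nlinarith [sq_nonneg (Real.sqrt n - ‖x‖)]
        calc _ ≤ 2 * (D + ‖T‖ ^ 2) * (2 * (d + ‖x‖ ^ 2)) * ((d / D) / (d + ‖x‖ ^ 2)) ^ 2 := by
              gcongr
          _ = 4 * ((d / D) * (D + ‖T‖ ^ 2) / (d + ‖x‖ ^ 2)) * (d / D) := by field_simp; ring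
          _ ≤ 4 * M * 1 := by
              gcongr
              exact (div_le_one hD).2 hdD
          _ = _ := by ring
    calc _ ≤ 2 * Y * ((1 + η) * (sW * (Real.sqrt n + ‖T‖))) * (sV * (Real.sqrt n + ‖x‖)) *
          ((d / D) / (cV * (d + ‖x‖ ^ 2))) := by gcongr
      _ = (1 + η) * (2 * Y * (sV * sW / cV)) *
          ((Real.sqrt n + ‖T‖) * (Real.sqrt n + ‖x‖) * ((d / D) / (d + ‖x‖ ^ 2))) := by
          field_simp
      _ ≤ (1 + η) * (2 * Y * (sV * sW / cV)) * (2 * Real.sqrt M) := by gcongr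
      _ = _ := by ring
  have t3 : 2 * η * (sW * (Real.sqrt n + ‖T‖) * ‖T‖ + (D + W T)) / ‖z‖ ^ 2
      ≤ 2 * β * Y * (sW * (n + 2 * N) + CW * (D + N)) := by
    have hφ1 : 0 < 1 + φ x := by linarith
    have c1 : (Real.sqrt n + ‖T‖) * ‖T‖ ≤ (n + 2 * N) * (1 + φ x) := by
      nlinarith [sq_nonneg (Real.sqrt n - ‖T‖), mul_nonneg (Nat.cast_nonneg (α := ℝ) n) hφ0]
    have c2 : D + W T ≤ CW * (D + N) * (1 + φ x) := by
      calc D + W T ≤ CW * (D + ‖T‖ ^ 2) := uW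
        _ ≤ CW * ((D + N) * (1 + φ x)) := by
          gcongr; nlinarith [mul_nonneg hD.le hφ0]
        _ = _ := by ring
    have c3 : sW * (Real.sqrt n + ‖T‖) * ‖T‖ + (D + W T) ≤
        (sW * (n + 2 * N) + CW * (D + N)) * (1 + φ x) := by
      have : sW * ((Real.sqrt n + ‖T‖) * ‖T‖) ≤ sW * ((n + 2 * N) * (1 + φ x)) := by gcongr
      nlinarith
    have hE : 0 ≤ sW * (n + 2 * N) + CW * (D + N) := by positivity
    have hL : 0 ≤ (sW * (n + 2 * N) + CW * (D + N)) * (1 + φ x) := by positivity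
    rw [div_le_iff₀ (by positivity)]
    calc _ ≤ 2 * η * ((sW * (n + 2 * N) + CW * (D + N)) * (1 + φ x)) := by gcongr
      _ ≤ 2 * (β * ‖z‖ ^ 2 * Y / (1 + φ x)) * ((sW * (n + 2 * N) + CW * (D + N)) * (1 + φ x)) := by
          gcongr
      _ = _ := by field_simp
  linarith

end Ctx

lemma second_deriv_max (g g' : ℝ → ℝ) (L : ℝ) (h1 : ∀ t, HasDerivAt g (g' t) t)
    (h2 : HasDerivAt g' L 0) (hmax : ∀ᶠ t in nhds 0, g t ≤ g 0) : g' 0 = 0 ∧ L ≤ 0 := by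
  have hlm : IsLocalMax g 0 := hmax
  have h0 : g' 0 = 0 := hlm.hasDerivAt_eq_zero (h1 0)
  refine ⟨h0, ?_⟩
  by_contra hL
  push Not at hL
  have e : deriv g = g' := funext fun t => (h1 t).deriv
  have hmin : IsLocalMin g 0 := by
    apply isLocalMin_of_deriv_deriv_pos
    · rw [e, h2.deriv]; exact hL
    · rw [e]; exact h0
    · exact (h1 0).continuousAt
  have hc : g =ᶠ[nhds 0] fun _ => g 0 := by
    filter_upwards [hmin, hmax] with t ht ht2 using le_antisymm ht2 ht
  have hd : deriv g =ᶠ[nhds 0] fun _ => 0 := by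
    have := hc.deriv
    simpa using this
  have : deriv (deriv g) 0 = 0 := by rw [hd.deriv_eq]; simp
  rw [e, h2.deriv] at this
  linarith

lemma x_opt {n : ℕ} {φ P : Euc n → ℝ} (hφ : ContDiff ℝ 2 φ) (hP : ContDiff ℝ 2 P)
    (x z : Euc n) (k : ℝ)
    (hmax : ∀ y, φ (y + z) + φ (y - z) - 2 * φ y - k * P y ≤
      φ (x + z) + φ (x - z) - 2 * φ x - k * P x) :
    gradient φ (x + z) + gradient φ (x - z) = (2 : ℝ) • gradient φ x + k • gradient P x ∧
    ∀ v, hess φ (x + z) v + hess φ (x - z) v ≤ 2 * hess φ x v + k * hess P x v := by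
  have key : ∀ v, (⟪gradient φ (x + z), v⟫ + ⟪gradient φ (x - z), v⟫ - 2 * ⟪gradient φ x, v⟫
      - k * ⟪gradient P x, v⟫ = 0) ∧
      hess φ (x + z) v + hess φ (x - z) v - 2 * hess φ x v - k * hess P x v ≤ 0 := by
    intro v
    have := second_deriv_max
      (fun t => φ ((x + z) + t • v) + φ ((x - z) + t • v) - 2 * φ (x + t • v) - k * P (x + t • v))
      (fun t => ⟪gradient φ ((x + z) + t • v), v⟫ + ⟪gradient φ ((x - z) + t • v), v⟫
        - 2 * ⟪gradient φ (x + t • v), v⟫ - k * ⟪gradient P (x + t • v), v⟫)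
      (hess φ (x + z) v + hess φ (x - z) v - 2 * hess φ x v - k * hess P x v)
      (fun t => (((line_deriv hφ (x + z) v t).add (line_deriv hφ (x - z) v t)).sub
        ((line_deriv hφ x v t).const_mul 2)).sub ((line_deriv hP x v t).const_mul k))
      (by
        have a1 := line_deriv2 hφ (x + z) v 0
        have a2 := line_deriv2 hφ (x - z) v 0
        have a3 := line_deriv2 hφ x v 0
        have a4 := line_deriv2 hP x v 0
        simp only [zero_smul, add_zero] at a1 a2 a3 a4
        exact ((a1.add a2).sub (a3.const_mul 2)).sub (a4.const_mul k))
      (by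
        refine Filter.Eventually.of_forall fun t => ?_
        have := hmax (x + t • v)
        have e1 : x + t • v + z = x + z + t • v := by abel
        have e2 : x + t • v - z = x - z + t • v := by abel
        rw [e1, e2] at this
        simpa only [zero_smul, add_zero] using this)
    simpa only [zero_smul, add_zero] using this
  refine ⟨?_, fun v => by linarith [(key v).2]⟩
  rw [← sub_eq_zero]
  apply ext_inner_right ℝ
  intro v
  have := (key v).1
  rw [inner_zero_left, inner_sub_left, inner_add_left, inner_add_left, inner_smul_left,
    inner_smul_left]
  simp only [conj_trivial]
  linarith

lemma z_opt {n : ℕ} {φ : Euc n → ℝ} (hφ : ContDiff ℝ 2 φ) (hc : ConvexOn ℝ univ φ)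
    (x z : Euc n) (hz : z ≠ 0) (C k : ℝ) (hC : 0 < C) (hk : 0 ≤ k)
    (hmax : ∀ y, ‖y‖ ≤ ‖z‖ → φ (x + y) + φ (x - y) - C * ‖y‖ ^ 2 - k * ‖y‖ ≤
      φ (x + z) + φ (x - z) - C * ‖z‖ ^ 2 - k * ‖z‖) :
    ∃ Y : ℝ, gradient φ (x + z) - gradient φ (x - z) = (2 * Y) • z ∧
      2 * C * ‖z‖ + k ≤ 2 * Y * ‖z‖ := by
  have hs : 0 < ‖z‖ := norm_pos_iff.2 hz
  set q := gradient φ (x + z) - gradient φ (x - z) with hq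
  have conv : ∀ y, φ (x + z) + φ (x - z) + ⟪q, y - z⟫ ≤ φ (x + y) + φ (x - y) := by
    intro y
    have h1 := conv_grad hφ hc (x + z) (x + y)
    have h2 := conv_grad hφ hc (x - z) (x - y)
    have e1 : x + y - (x + z) = y - z := by abel
    have e2 : x - y - (x - z) = -(y - z) := by abel
    rw [e1] at h1
    rw [e2, inner_neg_right] at h2
    rw [hq, inner_sub_left]
    linarith
  -- radial comparison
  have rad : ∀ t : ℝ, 0 < t → t < 1 → C * ‖z‖ ^ 2 * (2 - t) + k * ‖z‖ ≤ ⟪q, z⟫ := by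
    intro t ht0 ht1
    have h1 := conv ((1 - t) • z)
    have hn : ‖(1 - t) • z‖ = (1 - t) * ‖z‖ := by
      rw [norm_smul, Real.norm_of_nonneg (by linarith)]
    have h2 := hmax ((1 - t) • z) (by rw [hn]; nlinarith)
    rw [hn] at h2
    have e : (1 - t) • z - z = (-t) • z := by rw [sub_smul, one_smul, neg_smul]; abel
    rw [e, inner_smul_right] at h1
    have h3 : t * (C * ‖z‖ ^ 2 * (2 - t) + k * ‖z‖) ≤ t * ⟪q, z⟫ := by nlinarith
    exact le_of_mul_le_mul_left h3 ht0
  have rad2 : 2 * C * ‖z‖ ^ 2 + k * ‖z‖ ≤ ⟪q, z⟫ := by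
    apply le_of_forall_pos_le_add
    intro δ hδ
    have hCs : 0 < C * ‖z‖ ^ 2 := by positivity
    set t := min (1 / 2) (δ / (C * ‖z‖ ^ 2)) with ht
    have ht0 : 0 < t := by rw [ht]; apply lt_min <;> positivity
    have ht1 : t < 1 := lt_of_le_of_lt (min_le_left _ _) (by norm_num)
    have ht2 : t * (C * ‖z‖ ^ 2) ≤ δ := by
      have : t ≤ δ / (C * ‖z‖ ^ 2) := min_le_right _ _
      rwa [le_div_iff₀ hCs] at this
    have := rad t ht0 ht1
    linarith
  have hqz : 0 < ⟪q, z⟫ := lt_of_lt_of_le (by positivity) rad2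
  have hq0 : q ≠ 0 := by rintro h0; rw [h0, inner_zero_left] at hqz; exact lt_irrefl _ hqz
  have hqn : 0 < ‖q‖ := norm_pos_iff.2 hq0
  have tang : ‖q‖ * ‖z‖ ≤ ⟪q, z⟫ := by
    have hn : ‖(‖z‖ / ‖q‖) • q‖ = ‖z‖ := by
      rw [norm_smul, Real.norm_of_nonneg (by positivity)]; field_simp
    have h1 := conv ((‖z‖ / ‖q‖) • q)
    have h2 := hmax ((‖z‖ / ‖q‖) • q) hn.le
    rw [hn] at h2
    rw [inner_sub_right, inner_smul_right, real_inner_self_eq_norm_sq] at h1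
    have e : ‖z‖ / ‖q‖ * ‖q‖ ^ 2 = ‖q‖ * ‖z‖ := by field_simp
    rw [e] at h1
    linarith
  have heq : ⟪q, z⟫ = ‖q‖ * ‖z‖ := le_antisymm (real_inner_le_norm _ _) tang
  have hpar := inner_eq_norm_mul_iff_real.1 heq
  refine ⟨‖q‖ / ‖z‖ / 2, ?_, ?_⟩
  · have e : 2 * (‖q‖ / ‖z‖ / 2) = ‖z‖⁻¹ * ‖q‖ := by field_simp
    rw [e, mul_smul, ← hpar, smul_smul, inv_mul_cancel₀ hs.ne', one_smul]
  · have e : 2 * (‖q‖ / ‖z‖ / 2) * ‖z‖ = ‖q‖ := by field_simp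
    rw [e]
    rw [heq] at rad2
    have : (2 * C * ‖z‖ + k) * ‖z‖ ≤ ‖q‖ * ‖z‖ := by nlinarith
    exact le_of_mul_le_mul_right this hs

namespace Ctx
variable {n : ℕ} {V W φ : Euc n → ℝ} {d D cW2 CV2 cV CW sV sW M N : ℝ}

lemma maxpr (h : Ctx n V W φ d D cW2 CV2 cV CW sV sW M N) (P σ : Euc n → ℝ) (β C ε0 : ℝ)
    (hP : ContDiff ℝ 2 P) (hgP : ∀ x, gradient P x = σ x • gradient φ x)
    (hhP : ∀ x v, hess P x v ≤ σ x * hess φ x v) (hσ0 : ∀ x, 0 ≤ σ x) (hσ1 : ∀ x, σ x ≤ 1)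
    (hP0 : ∀ x, 0 < P x) (hβ0 : 0 ≤ β) (hβ : ∀ x, σ x * (1 + φ x) ≤ β * P x)
    (hco : ∀ ε : ℝ, 0 < ε → ∃ R : ℝ, ∀ x z : Euc n, R ≤ ‖x‖ → ‖z‖ ≤ 1 →
      φ (x + z) + φ (x - z) - 2 * φ x ≤ ε * ‖z‖ * P x)
    (hC : 0 < C) (hε0 : 0 < ε0)
    (hsmall : ∀ Y η : ℝ, C ≤ Y → 0 ≤ η → η ≤ ε0 →
      (1 + η) * (CV2 * CW * M / cV + 4 * Y * (sV * sW * Real.sqrt M / cV))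
      + 2 * β * Y * (sW * (n + 2 * N) + CW * (D + N)) < cW2 * Y ^ 2)
    (x1 z1 : Euc n) (hz1 : ‖z1‖ ≤ 1) :
    φ (x1 + z1) + φ (x1 - z1) - 2 * φ x1 ≤ C * ‖z1‖ ^ 2 := by
  by_contra hcon
  push Not at hcon
  set δ := φ (x1 + z1) + φ (x1 - z1) - 2 * φ x1 - C * ‖z1‖ ^ 2 with hδ
  have hδ0 : 0 < δ := by rw [hδ]; linarith
  have hP1 := hP0 x1
  set ε := min ε0 (δ / (2 * P x1)) with hε
  have hεp : 0 < ε := by rw [hε]; apply lt_min hε0; positivity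
  have hε1 : ε ≤ ε0 := min_le_left _ _
  have hε2 : ε * P x1 ≤ δ / 2 := by
    have : ε ≤ δ / (2 * P x1) := min_le_right _ _
    rw [le_div_iff₀ (by positivity)] at this
    linarith
  obtain ⟨R, hR⟩ := hco ε hεp
  set Φ : Euc n × Euc n → ℝ := fun w =>
    φ (w.1 + w.2) + φ (w.1 - w.2) - 2 * φ w.1 - C * ‖w.2‖ ^ 2 - ε * ‖w.2‖ * P w.1 with hΦ
  have hcφ := h.hφ.continuous
  have hcP := hP.continuous
  have hΦc : Continuous Φ := by rw [hΦ]; fun_prop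
  have hΦ1 : 0 < Φ (x1, z1) := by
    have : ε * ‖z1‖ * P x1 ≤ ε * P x1 := by
      have : ε * ‖z1‖ ≤ ε := mul_le_of_le_one_right hεp.le hz1
      gcongr
    simp only [hΦ]
    linarith
  set K := (closedBall (0 : Euc n) (max R ‖x1‖)) ×ˢ (closedBall (0 : Euc n) 1) with hK
  have hKc : IsCompact K := (isCompact_closedBall _ _).prod (isCompact_closedBall _ _)
  have h1K : (x1, z1) ∈ K := by simp [hK, hz1]
  obtain ⟨⟨x, z⟩, hxzK, hxz⟩ := hKc.exists_isMaxOn ⟨_, h1K⟩ hΦc.continuousOn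
  have hpos : 0 < Φ (x, z) := lt_of_lt_of_le hΦ1 (hxz h1K)
  have hz1' : ‖z‖ ≤ 1 := by
    have := hxzK.2
    simpa using this
  have hglob : ∀ y w : Euc n, ‖w‖ ≤ 1 → Φ (y, w) ≤ Φ (x, z) := by
    intro y w hw
    by_cases hy : ‖y‖ ≤ max R ‖x1‖
    · exact hxz (show (y, w) ∈ K by simp [hK, hw]; simpa using hy)
    · push Not at hy
      have h1 := hR y w ((le_max_left _ _).trans hy.le) hw
      have h2 : Φ (y, w) ≤ 0 := by
        simp only [hΦ]
        have : 0 ≤ C * ‖w‖ ^ 2 := by positivity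
        linarith
      linarith
  have hz : z ≠ 0 := by
    rintro rfl
    simp only [hΦ] at hpos
    simp at hpos
    linarith
  have hs : 0 < ‖z‖ := norm_pos_iff.2 hz
  have hPx := hP0 x
  obtain ⟨Y, hY1, hY2⟩ := z_opt h.hφ h.hc x z hz C (ε * P x) hC (by positivity) (by
    intro y hy
    have := hglob x y (hy.trans hz1')
    simp only [hΦ] at this
    linarith)
  obtain ⟨hX1, hX2⟩ := x_opt h.hφ hP x z (ε * ‖z‖) (by
    intro y
    have := hglob y z hz1'
    simp only [hΦ] at this
    linarith)
  have hεP : 0 < ε * P x := by positivity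
  have hYC : C ≤ Y := by
    have : C * ‖z‖ ≤ Y * ‖z‖ := by linarith
    exact le_of_mul_le_mul_right this hs
  have hYP : ε * P x ≤ 2 * Y * ‖z‖ := by
    have : 0 < C * ‖z‖ := by positivity
    linarith
  set η := ε * ‖z‖ * σ x / 2 with hη
  have hη0 : 0 ≤ η := by have := hσ0 x; positivity
  have hη1 : η ≤ ε0 := by
    have : ε * ‖z‖ * σ x ≤ ε * 1 * 1 := by
      have := hσ0 x; have := hσ1 x; gcongr
    rw [hη]; linarith
  rw [hgP] at hX1
  have hsum : gradient φ (x + z) + gradient φ (x - z) = (2 * (1 + η)) • gradient φ x := by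
    rw [hX1, smul_smul, ← add_smul]; congr 1; rw [hη]; ring
  have hp : gradient φ (x + z) = (1 + η) • gradient φ x + Y • z := by
    have : (2 : ℝ) • gradient φ (x + z) = (2 : ℝ) • ((1 + η) • gradient φ x + Y • z) := by
      calc (2 : ℝ) • gradient φ (x + z) = (gradient φ (x + z) + gradient φ (x - z)) +
            (gradient φ (x + z) - gradient φ (x - z)) := by rw [two_smul]; abel
        _ = _ := by rw [hsum, hY1, smul_add, smul_smul, smul_smul]
    exact smul_right_injective _ (two_ne_zero) this
  have hm : gradient φ (x - z) = (1 + η) • gradient φ x - Y • z := by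
    have : (2 : ℝ) • gradient φ (x - z) = (2 : ℝ) • ((1 + η) • gradient φ x - Y • z) := by
      calc (2 : ℝ) • gradient φ (x - z) = (gradient φ (x + z) + gradient φ (x - z)) -
            (gradient φ (x + z) - gradient φ (x - z)) := by rw [two_smul]; abel
        _ = _ := by rw [hsum, hY1, smul_sub, smul_smul, smul_smul]
    exact smul_right_injective _ (two_ne_zero) this
  have hφx := h.hφ0 x
  have hY0 : 0 < Y := by linarith
  have hηβ : η ≤ β * ‖z‖ ^ 2 * Y / (1 + φ x) := by
    rw [le_div_iff₀ (by linarith)]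
    calc η * (1 + φ x) = ε * ‖z‖ / 2 * (σ x * (1 + φ x)) := by rw [hη]; ring
      _ ≤ ε * ‖z‖ / 2 * (β * P x) := by have := hβ x; gcongr
      _ = β * ‖z‖ / 2 * (ε * P x) := by ring
      _ ≤ β * ‖z‖ / 2 * (2 * Y * ‖z‖) := by gcongr
      _ = _ := by ring
  have := h.crit2 x z η Y β hη0 hY0 hz hηβ hp hm (by
    intro v
    have a1 := hX2 v
    have a2 : ε * ‖z‖ * hess P x v ≤ ε * ‖z‖ * (σ x * hess φ x v) := by
      have := hhP x v; gcongr
    have a3 : 2 * (1 + η) * hess φ x v = 2 * hess φ x v + ε * ‖z‖ * (σ x * hess φ x v) := by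
      rw [hη]; ring
    linarith)
  have := hsmall Y η hYC hη0 hη1
  linarith

end Ctx

lemma grad_of_line {n : ℕ} {P : Euc n → ℝ} (hP : ContDiff ℝ 2 P) (x w : Euc n)
    (hl : ∀ v, HasDerivAt (fun t : ℝ => P (x + t • v)) ⟪w, v⟫ 0) : gradient P x = w := by
  apply ext_inner_right ℝ
  intro v
  have h1 := line_deriv hP x v 0
  rw [zero_smul, add_zero] at h1
  exact h1.unique (hl v)

lemma shift_facts {n : ℕ} {φ : Euc n → ℝ} (hφ : ContDiff ℝ 2 φ) (c : ℝ) :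
    ContDiff ℝ 2 (fun x => c + φ x) ∧ (gradient (fun x => c + φ x) = gradient φ) ∧
    ∀ x v, hess (fun x => c + φ x) x v = hess φ x v := by
  have h1 : ContDiff ℝ 2 (fun x => c + φ x) := contDiff_const.add hφ
  have h2 : gradient (fun x => c + φ x) = gradient φ := by
    funext x
    apply grad_of_line h1
    intro v
    have := line_deriv hφ x v 0
    rw [zero_smul, add_zero] at this
    exact this.const_add c
  refine ⟨h1, h2, fun x v => ?_⟩
  rw [hess_eq h1, hess_eq hφ, h2]

lemma log_facts {n : ℕ} {φ : Euc n → ℝ} (hφ : ContDiff ℝ 2 φ) (h0 : ∀ x, 0 ≤ φ x) (c : ℝ) :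
    ContDiff ℝ 2 (fun x => c + Real.log (1 + φ x)) ∧
    (∀ x, gradient (fun x => c + Real.log (1 + φ x)) x = (1 + φ x)⁻¹ • gradient φ x) ∧
    ∀ x v, hess (fun x => c + Real.log (1 + φ x)) x v ≤ (1 + φ x)⁻¹ * hess φ x v := by
  have hp : ∀ x, 0 < 1 + φ x := fun x => by linarith [h0 x]
  have h1 : ContDiff ℝ 2 (fun x => c + Real.log (1 + φ x)) :=
    contDiff_const.add ((contDiff_const.add hφ).log fun x => (hp x).ne')
  have h2 : ∀ x, gradient (fun x => c + Real.log (1 + φ x)) x = (1 + φ x)⁻¹ • gradient φ x := by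
    intro x
    apply grad_of_line h1
    intro v
    have := line_deriv hφ x v 0
    have h3 := ((this.const_add 1).log (hp _).ne').const_add c
    rw [zero_smul, add_zero] at h3
    rw [inner_smul_left]
    simp only [conj_trivial]
    rw [← div_eq_inv_mul]
    exact h3
  refine ⟨h1, h2, fun x v => ?_⟩
  have h3 := line_deriv2 h1 x v 0
  have h4 : (fun t : ℝ => ⟪gradient (fun x => c + Real.log (1 + φ x)) (x + t • v), v⟫)
      = fun t : ℝ => ⟪gradient φ (x + t • v), v⟫ / (1 + φ (x + t • v)) := by
    funext t
    rw [h2, inner_smul_left]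
    simp only [conj_trivial]
    rw [div_eq_inv_mul]
  rw [h4] at h3
  have h5 := (line_deriv2 hφ x v 0).div ((line_deriv hφ x v 0).const_add 1) (hp _).ne'
  have h6 := h3.unique h5
  simp only [zero_smul, add_zero] at h6
  rw [h6]
  have hpx := hp x
  rw [div_le_iff₀ (by positivity)]
  have e : (1 + φ x)⁻¹ * hess φ x v * (1 + φ x) ^ 2 = hess φ x v * (1 + φ x) := by field_simp
  rw [e]
  nlinarith [mul_self_nonneg ⟪gradient φ x, v⟫]

lemma hess_of_second_diff {n : ℕ} {φ : Euc n → ℝ} (hφ : ContDiff ℝ 2 φ) (C : ℝ) (x e : Euc n)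
    (he : ‖e‖ = 1)
    (h : ∀ z : Euc n, ‖z‖ ≤ 1 → φ (x + z) + φ (x - z) - 2 * φ x ≤ C * ‖z‖ ^ 2) :
    hess φ x e ≤ C := by
  have hneg : hess φ x (-e) = hess φ x e := by
    rw [hess_eq hφ, hess_eq hφ, map_neg, inner_neg_neg]
  have := second_deriv_max
    (fun t => φ (x + t • e) + φ (x + t • (-e)) - 2 * φ x - C * t ^ 2)
    (fun t => ⟪gradient φ (x + t • e), e⟫ + ⟪gradient φ (x + t • (-e)), -e⟫ - C * (2 * t))
    (hess φ x e + hess φ x (-e) - C * 2)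
    (by
      intro t
      have a := (hasDerivAt_pow 2 t).const_mul C
      have b := (((line_deriv hφ x e t).add (line_deriv hφ x (-e) t)).sub_const (2 * φ x)).sub a
      simp only [Nat.cast_ofNat, Nat.add_one_sub_one, pow_one] at b
      exact b)
    (by
      have a1 := line_deriv2 hφ x e 0
      have a2 := line_deriv2 hφ x (-e) 0
      simp only [zero_smul, add_zero] at a1 a2
      have a3 := ((hasDerivAt_id (0 : ℝ)).const_mul 2).const_mul C
      rw [mul_one] at a3
      exact (a1.add a2).sub a3)
    (by
      have : ∀ᶠ t : ℝ in nhds 0, |t| < 1 := by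
        have := Metric.ball_mem_nhds (0 : ℝ) one_pos
        filter_upwards [this] with t ht
        simpa using ht
      filter_upwards [this] with t ht
      have hn : ‖t • e‖ = |t| := by rw [norm_smul, he, mul_one, Real.norm_eq_abs]
      have := h (t • e) (by rw [hn]; exact ht.le)
      rw [hn, sq_abs] at this
      simp only [smul_neg, ← sub_eq_add_neg, zero_smul, add_zero, sub_zero]
      linarith)
  have h2 := this.2
  rw [hneg] at h2
  linarith

lemma lip_of_hess {n : ℕ} {φ : Euc n → ℝ} (hφ : ContDiff ℝ 2 φ) (hc : ConvexOn ℝ univ φ)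
    (C : ℝ) (hC : 0 < C) (h : ∀ x e : Euc n, ‖e‖ = 1 → hess φ x e ≤ C) (a b : Euc n) :
    ‖gradient φ a - gradient φ b‖ ≤ C * ‖a - b‖ := by
  have hs : ∀ x v : Euc n, hess φ x v ≤ C * ‖v‖ ^ 2 := by
    intro x v
    by_cases hv : v = 0
    · subst hv; rw [hess_eq hφ]; simp
    have hvn : 0 < ‖v‖ := norm_pos_iff.2 hv
    have h1 := h x (‖v‖⁻¹ • v) (by rw [norm_smul, norm_inv, norm_norm, inv_mul_cancel₀ hvn.ne'])
    rw [hess_eq hφ, map_smul, inner_smul_left, inner_smul_right] at h1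
    simp only [conj_trivial] at h1
    rw [hess_eq hφ]
    have h2 := mul_le_mul_of_nonneg_right h1 (sq_nonneg ‖v‖)
    calc _ = ‖v‖⁻¹ * (‖v‖⁻¹ * ⟪fderiv ℝ (gradient φ) x v, v⟫) * ‖v‖ ^ 2 := by field_simp
      _ ≤ _ := h2
  have hd : Differentiable ℝ (gradient φ) := (grad_contDiff hφ).differentiable (by norm_num)
  have hbound : ∀ x, ‖fderiv ℝ (gradient φ) x‖ ≤ C := by
    intro x
    apply ContinuousLinearMap.opNorm_le_bound _ hC.le
    intro v
    set L := fderiv ℝ (gradient φ) x with hL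
    have sym : ∀ v w, ⟪L v, w⟫ = ⟪v, L w⟫ := fun v w => hess_symm hφ x v w
    have psd := conv_hess hφ hc x (v - C⁻¹ • L v)
    have u1 := hs x (L v)
    have u2 := hs x v
    rw [hess_eq hφ, ← hL] at psd u1 u2
    have e : ⟪L (v - C⁻¹ • L v), v - C⁻¹ • L v⟫ =
        ⟪L v, v⟫ - 2 * C⁻¹ * ‖L v‖ ^ 2 + C⁻¹ ^ 2 * ⟪L (L v), L v⟫ := by
      rw [map_sub, map_smul, inner_sub_left, inner_sub_right, inner_sub_right, inner_smul_left,
        inner_smul_left, inner_smul_right, inner_smul_right, real_inner_self_eq_norm_sq,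
        sym (L v) v, real_inner_self_eq_norm_sq]
      simp only [conj_trivial]; ring
    rw [e] at psd
    have u3 : C⁻¹ ^ 2 * ⟪L (L v), L v⟫ ≤ C⁻¹ ^ 2 * (C * ‖L v‖ ^ 2) := by gcongr
    have e2 : C⁻¹ ^ 2 * (C * ‖L v‖ ^ 2) = C⁻¹ * ‖L v‖ ^ 2 := by field_simp
    have u4 : C⁻¹ * ‖L v‖ ^ 2 ≤ C * ‖v‖ ^ 2 := by linarith
    refine (pow_le_pow_iff_left₀ (norm_nonneg _) (by positivity) two_ne_zero).1 ?_
    calc ‖L v‖ ^ 2 = C * (C⁻¹ * ‖L v‖ ^ 2) := by field_simp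
      _ ≤ C * (C * ‖v‖ ^ 2) := by gcongr
      _ = _ := by ring
  exact (convex_univ).norm_image_sub_le_of_norm_fderiv_le (fun x _ => hd x)
    (fun x _ => hbound x) (mem_univ b) (mem_univ a)

lemma small_all (a b E c C κ : ℝ) (ha : 0 ≤ a) (hb : 0 ≤ b) (hE : 0 ≤ E) (hC : 0 < C)
    (hκ : κ = c * C ^ 2 - (a + b * C)) (hκ0 : 0 < κ) :
    ∃ ε0 β : ℝ, 0 < ε0 ∧ 0 < β ∧ ∀ Y η : ℝ, C ≤ Y → 0 ≤ η → η ≤ ε0 →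
      (1 + η) * (a + b * Y) + 2 * β * Y * E < c * Y ^ 2 := by
  refine ⟨κ / (3 * (a + b * C + 1)), κ / (3 * (2 * C * E + 1)), by positivity, by positivity, ?_⟩
  intro Y η hY hη hη1
  have hY0 : 0 < Y := by linarith
  have r1 : 1 ≤ Y / C := (one_le_div hC).2 hY
  set r := Y / C with hr
  have hYr : Y = C * r := by rw [hr]; field_simp
  have s1 : (1 + κ / (3 * (a + b * C + 1))) * (a + b * C) ≤ a + b * C + κ / 3 := by
    have : κ / (3 * (a + b * C + 1)) * (a + b * C) ≤ κ / 3 := by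
      rw [div_mul_eq_mul_div, div_le_div_iff₀ (by positivity) (by norm_num)]
      nlinarith
    linarith
  have s2 : 2 * (κ / (3 * (2 * C * E + 1))) * C * E ≤ κ / 3 := by
    have : 2 * (κ / (3 * (2 * C * E + 1))) * C * E = κ * (2 * C * E) / (3 * (2 * C * E + 1)) := by ring
    rw [this, div_le_div_iff₀ (by positivity) (by norm_num)]
    nlinarith
  have hrr : r ≤ r ^ 2 := by nlinarith
  have hr1 : 1 ≤ r ^ 2 := by nlinarith
  have t1 : (1 + η) * (a + b * Y) ≤ (a + b * C + κ / 3) * r ^ 2 := by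
    calc (1 + η) * (a + b * Y) ≤ (1 + κ / (3 * (a + b * C + 1))) * ((a + b * C) * r ^ 2) := by
          have : a + b * Y ≤ (a + b * C) * r ^ 2 := by
            rw [hYr]
            have : b * C * r ≤ b * C * r ^ 2 := by gcongr
            nlinarith
          gcongr
      _ = (1 + κ / (3 * (a + b * C + 1))) * (a + b * C) * r ^ 2 := by ring
      _ ≤ _ := by gcongr
  have t2 : 2 * (κ / (3 * (2 * C * E + 1))) * Y * E ≤ κ / 3 * r ^ 2 := by
    calc 2 * (κ / (3 * (2 * C * E + 1))) * Y * E
        = 2 * (κ / (3 * (2 * C * E + 1))) * C * E * r := by rw [hYr]; ring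
      _ ≤ 2 * (κ / (3 * (2 * C * E + 1))) * C * E * r ^ 2 := by gcongr
      _ ≤ _ := by gcongr
  have t3 : c * Y ^ 2 = (κ + (a + b * C)) * r ^ 2 := by rw [hκ, hYr]; ring
  rw [t3]
  nlinarith

namespace Ctx
variable {n : ℕ} {V W φ : Euc n → ℝ} {d D cW2 CV2 cV CW sV sW M N : ℝ}

lemma second_diff_le (h : Ctx n V W φ d D cW2 CV2 cV CW sV sW M N) (x z : Euc n) :
    φ (x + z) + φ (x - z) - 2 * φ x ≤ ‖z‖ * (‖gradient φ (x + z)‖ + ‖gradient φ (x - z)‖) := by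
  have h1 := conv_grad h.hφ h.hc (x + z) x
  have h2 := conv_grad h.hφ h.hc (x - z) x
  have e1 : x - (x + z) = -z := by abel
  have e2 : x - (x - z) = z := by abel
  rw [e1, inner_neg_right] at h1
  rw [e2] at h2
  have h3 := real_inner_le_norm (gradient φ (x + z)) z
  have h4 := abs_real_inner_le_norm (gradient φ (x - z)) z
  have h5 := neg_abs_le ⟪gradient φ (x - z), z⟫
  linarith

lemma step1 (h : Ctx n V W φ d D cW2 CV2 cV CW sV sW M N) (K : ℝ) (hK : 0 < K)
    (hT : ∀ x, ‖gradient φ x‖ ≤ K * (1 + ‖x‖))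
    (hsup : ∀ ε : ℝ, 0 < ε → ∃ R : ℝ, ∀ x : Euc n, R ≤ ‖x‖ → 1 + ‖x‖ ≤ ε * (1 + φ x)) :
    ∃ C : ℝ, 0 < C ∧ ∀ x z : Euc n, ‖z‖ ≤ 1 → φ (x + z) + φ (x - z) - 2 * φ x ≤ C * ‖z‖ ^ 2 := by
  have hCV := h.hCV2
  have hcV := h.hcV
  have hCW := h.hCW
  have hsV := h.hsV
  have hsW := h.hsW
  have hM := h.hM
  have hN := h.hN
  have hD := h.D_pos
  have hc := h.hcW2
  obtain ⟨f1, f2, f3⟩ := shift_facts h.hφ 1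
  set a := CV2 * CW * M / cV with ha
  set b := sV * sW * Real.sqrt M / cV with hb
  set E := sW * (n + 2 * N) + CW * (D + N) with hE
  have ha0 : 0 ≤ a := by positivity
  have hb0 : 0 ≤ b := by positivity
  have hE0 : 0 ≤ E := by positivity
  refine ⟨1 + (2 * a + 8 * b + 2 * E) / cW2, by positivity, fun x z hz => ?_⟩
  refine h.maxpr (fun x => 1 + φ x) (fun _ => 1) 1 _ 1 f1 (fun x => by rw [f2, one_smul])
    (fun x v => by rw [f3, one_mul]) (fun _ => zero_le_one) (fun _ => le_rfl)
    (fun x => by linarith [h.hφ0 x]) zero_le_one (fun x => le_rfl) ?_ (by positivity) one_pos ?_ x z hz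
  · intro ε hε
    obtain ⟨R, hR⟩ := hsup (ε / (4 * K)) (by positivity)
    refine ⟨R, fun x z hx hz => ?_⟩
    have h1 := h.second_diff_le x z
    have h2 : ∀ w : Euc n, ‖w‖ ≤ 1 → ‖gradient φ (x + w)‖ ≤ 2 * K * (1 + ‖x‖) := by
      intro w hw
      refine (hT _).trans ?_
      have : ‖x + w‖ ≤ ‖x‖ + 1 := (norm_add_le _ _).trans (by linarith)
      have : 1 + ‖x + w‖ ≤ 2 * (1 + ‖x‖) := by linarith [norm_nonneg x]
      calc _ ≤ K * (2 * (1 + ‖x‖)) := by gcongr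
        _ = _ := by ring
    have h3 := h2 z hz
    have h4 := h2 (-z) (by rwa [norm_neg])
    rw [← sub_eq_add_neg] at h4
    have h5 := hR x hx
    calc _ ≤ ‖z‖ * (2 * K * (1 + ‖x‖) + 2 * K * (1 + ‖x‖)) := h1.trans (by gcongr)
      _ = ‖z‖ * (4 * K) * (1 + ‖x‖) := by ring
      _ ≤ ‖z‖ * (4 * K) * (ε / (4 * K) * (1 + φ x)) := by gcongr
      _ = _ := by field_simp
  · intro Y η hY hη hη1
    have hY1 : 1 ≤ Y := by
      have : 0 ≤ (2 * a + 8 * b + 2 * E) / cW2 := by positivity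
      linarith
    have hY2 : 2 * a + 8 * b + 2 * E < cW2 * Y := by
      have : (2 * a + 8 * b + 2 * E) / cW2 < Y := by linarith
      rwa [div_lt_iff₀' hc] at this
    have hY0 : 0 < Y := by linarith
    calc (1 + η) * (a + 4 * Y * b) + 2 * 1 * Y * E ≤ (1 + 1) * (a * Y + 4 * Y * b) + 2 * 1 * Y * E := by
          gcongr
          nlinarith
      _ = (2 * a + 8 * b + 2 * E) * Y := by ring
      _ < cW2 * Y * Y := by gcongr
      _ = _ := by ring

lemma step2 (h : Ctx n V W φ d D cW2 CV2 cV CW sV sW M N) (K : ℝ) (hK : 0 < K)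
    (hT : ∀ x, ‖gradient φ x‖ ≤ K * (1 + ‖x‖))
    (hsup : ∀ ε : ℝ, 0 < ε → ∃ R : ℝ, ∀ x : Euc n, R ≤ ‖x‖ → 1 + ‖x‖ ≤ ε * (1 + φ x))
    (C : ℝ) (hC : 0 < C)
    (hgap : CV2 * CW * M / cV + 4 * (sV * sW * Real.sqrt M / cV) * C < cW2 * C ^ 2) :
    ∀ x z : Euc n, ‖z‖ ≤ 1 → φ (x + z) + φ (x - z) - 2 * φ x ≤ C * ‖z‖ ^ 2 := by
  have hCV := h.hCV2
  have hcV := h.hcV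
  have hCW := h.hCW
  have hsV := h.hsV
  have hsW := h.hsW
  have hM := h.hM
  have hN := h.hN
  have hD := h.D_pos
  have hc := h.hcW2
  obtain ⟨C1, hC1, hstep⟩ := h.step1 K hK hT hsup
  obtain ⟨ε0, β, hε0, hβ, hsm⟩ := small_all (CV2 * CW * M / cV) (4 * (sV * sW * Real.sqrt M / cV))
    (sW * (n + 2 * N) + CW * (D + N)) cW2 C _ (by positivity) (by positivity) (by positivity) hC rfl
    (by linarith)
  obtain ⟨f1, f2, f3⟩ := log_facts h.hφ h.hφ0 (1 / β)
  intro x z hz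
  have hlog : ∀ x, 0 ≤ Real.log (1 + φ x) := fun x => Real.log_nonneg (by linarith [h.hφ0 x])
  have hβ0 : 0 < 1 / β := by positivity
  refine h.maxpr (fun x => 1 / β + Real.log (1 + φ x)) (fun x => (1 + φ x)⁻¹) β C ε0 f1 f2 f3
    (fun x => by have := h.hφ0 x; positivity)
    (fun x => inv_le_one_of_one_le₀ (by linarith [h.hφ0 x]))
    (fun x => by linarith [hlog x]) hβ.le (fun x => ?_) ?_ hC hε0 ?_ x z hz
  · have h0 := h.hφ0 x
    rw [inv_mul_cancel₀ (by positivity), mul_add, mul_one_div_cancel hβ.ne']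
    have := mul_nonneg hβ.le (hlog x)
    linarith
  · intro ε hε
    obtain ⟨R, hR⟩ := hsup 1 one_pos
    refine ⟨max R (Real.exp (C1 / ε)), fun x z hx hz => ?_⟩
    have h1 := hR x ((le_max_left _ _).trans hx)
    have h2 : Real.exp (C1 / ε) ≤ 1 + φ x := by
      have := (le_max_right _ _).trans hx
      linarith
    have h3 : C1 / ε ≤ Real.log (1 + φ x) :=
      (Real.le_log_iff_exp_le (by linarith [h.hφ0 x])).2 h2
    have h4 : C1 ≤ ε * (1 / β + Real.log (1 + φ x)) := by
      rw [div_le_iff₀' hε] at h3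
      have : 0 < ε * (1 / β) := by positivity
      linarith
    calc _ ≤ C1 * ‖z‖ ^ 2 := hstep x z hz
      _ ≤ C1 * ‖z‖ := by
        gcongr
        nlinarith [norm_nonneg z]
      _ ≤ ε * (1 / β + Real.log (1 + φ x)) * ‖z‖ := by gcongr
      _ = _ := by ring
  · intro Y η hY hη hη1
    have := hsm Y η hY hη hη1
    have e : 4 * Y * (sV * sW * Real.sqrt M / cV) = 4 * (sV * sW * Real.sqrt M / cV) * Y := by ring
    rw [e]; exact this

end Ctx

lemma comp_of {n : ℕ} (hn : 1 ≤ n) {U : Euc n → ℝ} {p : ℝ} (hp : (n : ℝ) ≤ p)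
    (hU : ContDiff ℝ 2 U) (hZfin : Integrable fun x : Euc n => (1 + U x / p) ^ (-p))
    (hlow : 0 < cLow U (n : ℝ) univ) (hup : BddAbove (range (ratio0 U (n : ℝ)))) :
    Comp n U p (min 1 (cLow U (n : ℝ) univ)) (max 1 (cUp U (n : ℝ) univ)) := by
  have hn1 : (1 : ℝ) ≤ n := by exact_mod_cast hn
  have hbb : BddBelow (range (ratio0 U (n : ℝ))) := by
    by_contra hcon
    have : cLow U (n : ℝ) univ = 0 := by
      unfold cLow
      rw [image_univ]
      exact Real.sInf_of_not_bddBelow hcon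
    linarith
  have l1 : ∀ x, cLow U (n : ℝ) univ * (n + ‖x‖ ^ 2) ≤ n + U x := by
    intro x
    have hpos : (0 : ℝ) < n + ‖x‖ ^ 2 := by positivity
    rw [← le_div_iff₀ hpos]
    unfold cLow
    rw [image_univ]
    exact csInf_le hbb ⟨x, rfl⟩
  have l2 : ∀ x, n + U x ≤ cUp U (n : ℝ) univ * (n + ‖x‖ ^ 2) := by
    intro x
    have hpos : (0 : ℝ) < n + ‖x‖ ^ 2 := by positivity
    rw [← div_le_iff₀ hpos]
    unfold cUp
    rw [image_univ]
    exact le_csSup hup ⟨x, rfl⟩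
  refine ⟨hn, hp, hU.continuous, lt_min one_pos hlow, lt_of_lt_of_le one_pos (le_max_left _ _),
    fun x => ?_, fun x => ?_, hZfin⟩
  · have hpos : (0 : ℝ) ≤ n + ‖x‖ ^ 2 := by positivity
    have a1 := mul_le_mul_of_nonneg_right (min_le_right 1 (cLow U (n : ℝ) univ)) hpos
    have a2 := mul_le_mul_of_nonneg_right (min_le_left 1 (cLow U (n : ℝ) univ)) (sub_nonneg.2 hp)
    nlinarith [l1 x]
  · have hpos : (0 : ℝ) ≤ n + ‖x‖ ^ 2 := by positivity
    have a1 := mul_le_mul_of_nonneg_right (le_max_right 1 (cUp U (n : ℝ) univ)) hpos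
    have a2 := mul_le_mul_of_nonneg_right (le_max_left 1 (cUp U (n : ℝ) univ)) (sub_nonneg.2 hp)
    nlinarith [l2 x]

lemma grad_of_ratio1 {n : ℕ} (hn : 1 ≤ n) {U : Euc n → ℝ}
    (hup : BddAbove (range (ratio1 U (n : ℝ)))) :
    0 ≤ cGrad U (n : ℝ) univ ∧
    ∀ x, ‖gradient U x‖ ≤ Real.sqrt (cGrad U (n : ℝ) univ) * (Real.sqrt n + ‖x‖) := by
  have hn1 : (1 : ℝ) ≤ n := by exact_mod_cast hn
  have hs : 0 < Real.sqrt n := Real.sqrt_pos.2 (by linarith)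
  have h0 : 0 ≤ cGrad U (n : ℝ) univ := by
    apply Real.sSup_nonneg
    rintro _ ⟨x, -, rfl⟩
    unfold ratio1
    positivity
  refine ⟨h0, fun x => ?_⟩
  have hp : 0 < Real.sqrt n + ‖x‖ := by positivity
  have h1 : ratio1 U (n : ℝ) x ≤ cGrad U (n : ℝ) univ := by
    unfold cGrad
    rw [image_univ]
    exact le_csSup hup ⟨x, rfl⟩
  unfold ratio1 at h1
  rw [div_le_iff₀ (by positivity)] at h1
  apply le_of_sq_le_sq _ (by positivity)
  rw [mul_pow, Real.sq_sqrt h0]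
  exact h1

lemma gap_alg {CV2 CW M cV cW2 LV LW A B C : ℝ} (hM : 0 < M) (hcV : 0 < cV) (hcW2 : 0 < cW2)
    (hCV2 : 0 < CV2) (hCW : 0 < CW) (hLV : 0 ≤ LV) (hLW : 0 ≤ LW)
    (hA : A = CV2 * CW * M / (cW2 * cV))
    (hB : B = 8 * LV * LW * M / (cW2 ^ 2 * cV ^ 2))
    (hC : Real.sqrt (A + B) + Real.sqrt B < C) :
    CV2 * CW * M / cV + 4 * (Real.sqrt LV * Real.sqrt LW * Real.sqrt M / cV) * C
      < cW2 * C ^ 2 := by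
  have hA0 : 0 < A := by rw [hA]; positivity
  have hB0 : 0 ≤ B := by rw [hB]; positivity
  have e1 : CV2 * CW * M / cV = cW2 * A := by rw [hA]; field_simp
  have hs0 := Real.sqrt_nonneg (A + B)
  have hs1 := Real.sqrt_nonneg B
  have hC0 : 0 < C := by linarith
  have q1 := Real.sq_sqrt (add_nonneg hA0.le hB0)
  have q2 := Real.sq_sqrt hB0
  have e2 : 2 * (Real.sqrt LV * Real.sqrt LW * Real.sqrt M / cV) / cW2 ≤ Real.sqrt B := by
    apply Real.le_sqrt_of_sq_le
    have : (2 * (Real.sqrt LV * Real.sqrt LW * Real.sqrt M / cV) / cW2) ^ 2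
        = 4 * (Real.sqrt LV ^ 2 * Real.sqrt LW ^ 2 * Real.sqrt M ^ 2) / (cW2 ^ 2 * cV ^ 2) := by
      field_simp
      ring
    rw [this, Real.sq_sqrt hLV, Real.sq_sqrt hLW, Real.sq_sqrt hM.le, hB]
    apply div_le_div_of_nonneg_right _ (by positivity)
    have : 0 ≤ LV * LW * M := by positivity
    nlinarith
  rw [div_le_iff₀ hcW2] at e2
  have e3 := mul_le_mul_of_nonneg_right e2 hC0.le
  have e4 : A + 2 * Real.sqrt B * C < C ^ 2 := by nlinarith
  have e5 := mul_lt_mul_of_pos_left e4 hcW2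
  rw [e1]
  nlinarith

/-- **Global dimension-free Hessian estimate** (finite parameters `n ≤ d ≤ D < ∞`). -/
theorem global_dimension_free_hessian_estimate
    {n : ℕ} (hn : 1 ≤ n) (d D : ℝ) (hnd : (n : ℝ) ≤ d) (hdD : d ≤ D)
    (V W : Euc n → ℝ) (hVreg : ContDiff ℝ 2 V) (hWreg : ContDiff ℝ 2 W)
    (hVlow : ∀ x, -d < V x) (hWlow : ∀ y, -D < W y)
    (hZV : Integrable fun x : Euc n => (1 + V x / d) ^ (-d))
    (hZW : Integrable fun y : Euc n => (1 + W y / D) ^ (-D))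
    (CV2 cW2 : ℝ) (hCV2 : 0 < CV2) (hcW2 : 0 < cW2)
    (hHessV : ∀ x v : Euc n, hess V x v ≤ CV2 * ‖v‖ ^ 2)
    (hHessW : ∀ y v : Euc n, cW2 * ‖v‖ ^ 2 ≤ hess W y v)
    (φ : Euc n → ℝ) (hφreg : ContDiff ℝ 2 φ) (hφconv : ConvexOn ℝ univ φ)
    (hpush : Measure.map (fun x => gradient φ x) (muUP V d) = muUP W D)
    (hc0V : 0 < cLow V (n : ℝ) univ) (hc0W : 0 < cLow W (n : ℝ) univ)
    (hC0V : BddAbove (range (ratio0 V (n : ℝ))))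
    (hC0W : BddAbove (range (ratio0 W (n : ℝ))))
    (hC1V : BddAbove (range (ratio1 V (n : ℝ))))
    (hC1W : BddAbove (range (ratio1 W (n : ℝ))))
    (qV qW cV CW LV LW M A B Cglob : ℝ)
    (hqV : qV = max 1 (cUp V (n : ℝ) univ) / min 1 (cLow V (n : ℝ) univ))
    (hqW : qW = max 1 (cUp W (n : ℝ) univ) / min 1 (cLow W (n : ℝ) univ))
    (hcV : cV = min 1 (cLow V (n : ℝ) univ))
    (hCW : CW = max 1 (cUp W (n : ℝ) univ))
    (hLV : LV = cGrad V (n : ℝ) univ)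
    (hLW : LW = cGrad W (n : ℝ) univ)
    (hM : M = 10 ^ 6 * qV ^ 2 * qW ^ 2)
    (hA : A = CV2 * CW * M / (cW2 * cV))
    (hB : B = 8 * LV * LW * M / (cW2 ^ 2 * cV ^ 2))
    (hC : Cglob = Real.sqrt (A + B) + Real.sqrt B) :
    (∀ (x e : Euc n), ‖e‖ = 1 → hess φ x e ≤ Cglob) ∧
      ∀ a b : Euc n, ‖gradient φ a - gradient φ b‖ ≤ Cglob * ‖a - b‖ := by
  have hVc := comp_of hn hnd hVreg hZV hc0V hC0V
  have hWc := comp_of hn (hnd.trans hdD) hWreg hZW hc0W hC0W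
  have hqV1 : 1 ≤ qV := by
    rw [hqV, one_le_div hVc.hc]; exact (min_le_left _ _).trans (le_max_left _ _)
  have hqW1 : 1 ≤ qW := by
    rw [hqW, one_le_div hWc.hc]; exact (min_le_left _ _).trans (le_max_left _ _)
  have hM0 : 0 < M := by rw [hM]; positivity
  obtain ⟨hLV0, hgV⟩ := grad_of_ratio1 hn hC1V
  obtain ⟨hLW0, hgW⟩ := grad_of_ratio1 hn hC1W
  rw [← hLV] at hLV0 hgV
  rw [← hLW] at hLW0 hgW
  have hquant := growth_quant hVc hWc hdD hφreg hφconv hpush (by rwa [← hqV]) (by rwa [← hqW])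
  rw [← hqV, ← hqW, ← hM] at hquant
  have hVl := hVc.hlow
  have hWu := hWc.hup
  have hcV0 := hVc.hc
  have hCW0 := hWc.hC
  rw [← hcV] at hVl hcV0
  rw [← hCW] at hWu hCW0
  obtain ⟨K, α, hK, hα, hα1, hgr⟩ := growth_qual hVc hWc hdD hφreg hφconv hpush
  have hsurj := T_surj hVc hWc hφreg hpush K α hK hα (fun x => (hgr x).2)
  obtain ⟨w0, N, hN, hmin, hφN, hsup⟩ := phi_growth hφreg hφconv hsurj K α hK hα hα1
    (fun x => (hgr x).1) (fun x => (hgr x).2)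
  obtain ⟨f1, f2, f3⟩ := shift_facts hφreg (-φ w0)
  have ctx : Ctx n V W (fun x => -φ w0 + φ x) d D cW2 CV2 cV CW (Real.sqrt LV) (Real.sqrt LW)
      M N :=
    { hn := hn
      hnd := hnd
      hdD := hdD
      hV := hVreg
      hW := hWreg
      hφ := f1
      hc := (convexOn_const _ convex_univ).add hφconv
      hCV2 := hCV2
      hcW2 := hcW2
      hHV := hHessV
      hHW := hHessW
      hcV := hcV0
      hCW := hCW0
      lowV := hVl
      upW := hWu
      posW := fun y => by linarith [hWlow y]
      hsV := Real.sqrt_nonneg _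
      hsW := Real.sqrt_nonneg _
      gV := hgV
      gW := hgW
      hM := hM0
      grow := fun x => by rw [f2]; exact hquant x
      hN := hN
      hφ0 := fun x => by linarith [hmin x]
      hφN := fun x => by
        rw [f2]
        have h1 := hφN x
        rwa [sub_eq_neg_add] at h1
      hMA := by rw [f2]; exact ma_root hVc hWc hφreg hφconv hpush }
  have hT : ∀ x : Euc n, ‖gradient (fun x => -φ w0 + φ x) x‖ ≤ K * (1 + ‖x‖) := by
    intro x
    rw [f2]
    refine (hgr x).1.trans (mul_le_mul_of_nonneg_left ?_ hK.le)
    exact Real.rpow_le_self_of_one_le (by linarith [norm_nonneg x]) hα1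
  have hsup2 : ∀ ε : ℝ, 0 < ε → ∃ R : ℝ, ∀ x : Euc n, R ≤ ‖x‖ →
      1 + ‖x‖ ≤ ε * (1 + (-φ w0 + φ x)) := by
    intro ε hε
    obtain ⟨R, hR⟩ := hsup ε hε
    refine ⟨R, fun x hx => ?_⟩
    have h1 := hR x hx
    rwa [sub_eq_neg_add] at h1
  have hA0 : 0 < A := by rw [hA]; positivity
  have hB0 : 0 ≤ B := by rw [hB]; positivity
  have hCg : 0 < Cglob := by
    rw [hC]
    have : 0 < Real.sqrt (A + B) := Real.sqrt_pos.2 (by linarith)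
    have := Real.sqrt_nonneg B
    linarith
  have main : ∀ (x e : Euc n), ‖e‖ = 1 → hess φ x e ≤ Cglob := by
    intro x e he
    apply le_of_forall_gt_imp_ge_of_dense
    intro C hCC
    rw [← f3 x e]
    have hgap := gap_alg hM0 hcV0 hcW2 hCV2 hCW0 hLV0 hLW0 hA hB (hC ▸ hCC)
    exact hess_of_second_diff f1 C x e he
      (ctx.step2 K hK hT hsup2 C (hCg.trans hCC) hgap x)
  exact ⟨main, lip_of_hess hφreg hφconv Cglob hCg main⟩
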